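/- Let n be a positive integer and let T : 𝓢(M_n(ℝ) × M_n(ℝ), ℂ) → ℂ be a tempered distribution such that for all g, h ∈ GL_n(ℝ) and every Schwartz function φ one has T((x,y) ↦ φ(g x h⁻¹, h y g⁻¹)) = T(φ). Then T((x,y) ↦ φ(xᵀ, yᵀ)) = T(φ) for every Schwartz function φ. -/

import Mathlib

/-!
Tempered-distribution form, over `k = ℝ`, of part (b) of Theorem D:
a tempered distribution on `Mₙ(ℝ) × Mₙ(ℝ)` invariant under
`(x, y) ↦ (g x h⁻¹, h y g⁻¹)` for all `g, h ∈ GLₙ(ℝ)` is invariant under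
`(x, y) ↦ (xᵀ, yᵀ)`.
-/

/-- A tensor on a finite-dimensional Euclidean space which is infinitesimally `SO(n)`-invariant,
invariant under the coordinate reflections, and all of whose contractions vanish, is zero. -/
theorem orthogonal_invariant_traceless_eq_zero {n : ℕ} {σ : Type} [Fintype σ] [DecidableEq σ]
    [Nonempty σ] (t : (σ → Fin n) → ℝ)
    (hso : ∀ (p q : Fin n) (i : σ → Fin n),
      ∑ s, (if i s = p then t (Function.update i s q) else 0) =
        ∑ s, (if i s = q then t (Function.update i s p) else 0))
    (hrefl : ∀ (p : Fin n) (i : σ → Fin n),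
      t i = (∏ s, if i s = p then (-1 : ℝ) else 1) * t i)
    (htr : ∀ (s s' : σ) (i : σ → Fin n), s ≠ s' →
      ∑ c, t (Function.update (Function.update i s c) s' c) = 0) :
    t = 0 := by
  classical
  set E : Fin n → Fin n → (σ → Fin n) → ℝ := fun p q i =>
    ∑ s, (if i s = p then t (Function.update i s q) else 0) with hE
  have hsym : ∀ p q i, E p q i = E q p i := hso
  -- the cross terms
  have hcross : ∀ s s' : σ, s ≠ s' →
      ∑ i : σ → Fin n, t (Function.update i s (i s')) * t (Function.update i s' (i s)) = 0 := by
    intro s s' hs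
    have key : ∀ G : (σ → Fin n) → ℝ, (∀ i, ∑ c, G (Function.update i s c) = 0) →
        ∑ i, G i = 0 := by
      intro G hG
      rw [← (Equiv.funSplitAt s (Fin n)).symm.sum_comp, Fintype.sum_prod_type_right]
      refine Finset.sum_eq_zero fun r _ => ?_
      rcases isEmpty_or_nonempty (Fin n) with h | h
      · simp
      · obtain ⟨c₀⟩ := h
        rw [← hG ((Equiv.funSplitAt s (Fin n)).symm (c₀, r))]
        refine Finset.sum_congr rfl fun c _ => ?_
        congr 1
        ext x
        by_cases hx : x = s
        · subst hx; simp [Equiv.funSplitAt, Equiv.piSplitAt]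
        · simp [Equiv.funSplitAt, Equiv.piSplitAt, hx]
    apply key
    intro i
    have : ∀ c, t (Function.update (Function.update i s c) s (Function.update i s c s')) *
        t (Function.update (Function.update i s c) s' (Function.update i s c s)) =
        t (Function.update i s (i s')) * t (Function.update (Function.update i s c) s' c) := by
      intro c
      simp [hs.symm]
    rw [Finset.sum_congr rfl fun c _ => this c, ← Finset.mul_sum, htr s s' i hs, mul_zero]
  have htotal : ∑ p, ∑ q, ∑ i, E p q i * E q p i =
      Fintype.card σ * ∑ i, t i ^ 2 := by
    have h1 : ∀ i : σ → Fin n, ∑ p, ∑ q, E p q i * E q p i =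
        ∑ s, ∑ s', t (Function.update i s (i s')) * t (Function.update i s' (i s)) := by
      intro i
      simp only [hE, Finset.sum_mul_sum]
      have : ∀ p q : Fin n, ∑ s, ∑ s', (if i s = p then t (Function.update i s q) else 0) *
          (if i s' = q then t (Function.update i s' p) else 0) =
          ∑ s, ∑ s', if i s = p then (if i s' = q then
            t (Function.update i s q) * t (Function.update i s' p) else 0) else 0 := by
        intro p q
        refine Finset.sum_congr rfl fun s _ => Finset.sum_congr rfl fun s' _ => ?_
        split_ifs <;> simp
      simp only [this]
      rw [Finset.sum_congr rfl fun p _ => Finset.sum_comm, Finset.sum_comm]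
      refine Finset.sum_congr rfl fun s _ => ?_
      rw [Finset.sum_congr rfl fun p _ => Finset.sum_comm, Finset.sum_comm]
      refine Finset.sum_congr rfl fun s' _ => ?_
      rw [Finset.sum_eq_single (i s), Finset.sum_eq_single (i s')] <;> simp +contextual [eq_comm]
    calc ∑ p, ∑ q, ∑ i, E p q i * E q p i = ∑ i, ∑ p, ∑ q, E p q i * E q p i := by
          rw [Finset.sum_congr rfl fun p _ => Finset.sum_comm, Finset.sum_comm]
      _ = ∑ i, ∑ s, ∑ s', t (Function.update i s (i s')) * t (Function.update i s' (i s)) :=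
          Finset.sum_congr rfl fun i _ => h1 i
      _ = ∑ s, ∑ s', ∑ i : σ → Fin n,
            t (Function.update i s (i s')) * t (Function.update i s' (i s)) := by
          rw [Finset.sum_comm]
          exact Finset.sum_congr rfl fun s _ => Finset.sum_comm
      _ = ∑ s : σ, ∑ i, t i ^ 2 := by
          refine Finset.sum_congr rfl fun s _ => ?_
          rw [Finset.sum_eq_single s]
          · simp [sq]
          · intro s' _ h
            exact hcross s s' h.symm
          · simp
      _ = _ := by simp
  have hdiag : ∀ p i, E p p i = (Finset.univ.filter fun s => i s = p).card * t i := by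
    intro p i
    have : ∀ s, (if i s = p then t (Function.update i s p) else 0) =
        if i s = p then t i else 0 := by
      intro s
      split_ifs with h
      · rw [← h, Function.update_eq_self]
      · rfl
    change ∑ s, (if i s = p then t (Function.update i s p) else 0) = _
    rw [Finset.sum_congr rfl fun s _ => this s, ← Finset.sum_filter, Finset.sum_const, nsmul_eq_mul]
  have heven : ∀ p i, t i ≠ 0 → Even (Finset.univ.filter fun s => i s = p).card := by
    intro p i hi
    have h := hrefl p i
    rw [Finset.prod_ite, Finset.prod_const, Finset.prod_const_one, mul_one] at h
    by_contra hodd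
    rw [Nat.not_even_iff_odd] at hodd
    rw [hodd.neg_one_pow] at h
    apply hi
    linarith
  have hlow : ∀ i, 2 * (Fintype.card σ : ℝ) * t i ^ 2 ≤ ∑ p, E p p i ^ 2 := by
    intro i
    by_cases hi : t i = 0
    · rw [hi]
      simpa using Finset.sum_nonneg fun p _ => sq_nonneg _
    have hcard : (Fintype.card σ : ℝ) =
        ∑ p, ((Finset.univ.filter fun s => i s = p).card : ℝ) := by
      rw [← Finset.card_univ]
      exact_mod_cast Finset.card_eq_sum_card_fiberwise (f := i) (t := Finset.univ) (by simp)
    rw [hcard, Finset.mul_sum, Finset.sum_mul]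
    refine Finset.sum_le_sum fun p _ => ?_
    rw [hdiag, mul_pow]
    refine mul_le_mul_of_nonneg_right ?_ (sq_nonneg _)
    obtain ⟨k, hk⟩ := heven p i hi
    rw [hk]
    rcases Nat.eq_zero_or_pos k with h | h
    · simp [h]
    · have : (1 : ℝ) ≤ k := by exact_mod_cast h
      push_cast
      nlinarith
  have hcmp : ∑ i, ∑ p, E p p i ^ 2 ≤ ∑ p, ∑ q, ∑ i, E p q i * E q p i := by
    rw [Finset.sum_comm]
    refine Finset.sum_le_sum fun p _ => ?_
    have : ∀ q ∈ Finset.univ, 0 ≤ ∑ i, E p q i * E q p i := fun q _ =>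
      Finset.sum_nonneg fun i _ => by rw [hsym q p]; exact mul_self_nonneg _
    refine le_trans (le_of_eq ?_) (Finset.single_le_sum this (Finset.mem_univ p))
    exact Finset.sum_congr rfl fun i _ => sq _
  have hfin : ∑ i, t i ^ 2 = 0 := by
    have h1 := Finset.sum_le_sum fun i (_ : i ∈ Finset.univ) => hlow i
    rw [← Finset.mul_sum] at h1
    have h2 := h1.trans (hcmp.trans htotal.le)
    have h3 : (0 : ℝ) < Fintype.card σ := by exact_mod_cast Fintype.card_pos
    have h4 : 0 ≤ ∑ i, t i ^ 2 := Finset.sum_nonneg fun i _ => sq_nonneg _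
    nlinarith
  ext i
  have := (Finset.sum_eq_zero_iff_of_nonneg fun i _ => sq_nonneg (t i)).1 hfin i (Finset.mem_univ _)
  simpa using this

section TraceWords

open Matrix

variable {n : ℕ} {R : Type*}

/-- The matrix `A` or `B`, according to a Boolean. -/
def boolMatrix (A B : Matrix (Fin n) (Fin n) R) (s : Bool) : Matrix (Fin n) (Fin n) R :=
  if s then B else A

theorem boolMatrix_transpose_arg (A B : Matrix (Fin n) (Fin n) R) (b : Bool) :
    boolMatrix Aᵀ Bᵀ b = (boolMatrix A B b)ᵀ := by
  cases b <;> rfl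

variable [CommRing R]

/-- The product of the matrices `Lₛᵀ * Lₜ` along a word of pairs `(s, t)`. -/
def gramWord (A B : Matrix (Fin n) (Fin n) R) (w : List (Bool × Bool)) :
    Matrix (Fin n) (Fin n) R :=
  (w.map fun g => (boolMatrix A B g.1)ᵀ * boolMatrix A B g.2).prod

theorem gramWord_nil (A B : Matrix (Fin n) (Fin n) R) : gramWord A B [] = 1 := rfl

theorem gramWord_cons (A B : Matrix (Fin n) (Fin n) R) (g : Bool × Bool)
    (w : List (Bool × Bool)) :
    gramWord A B (g :: w) =
      (boolMatrix A B g.1)ᵀ * boolMatrix A B g.2 * gramWord A B w := by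
  simp [gramWord]

theorem gramWord_append (A B : Matrix (Fin n) (Fin n) R) (v w : List (Bool × Bool)) :
    gramWord A B (v ++ w) = gramWord A B v * gramWord A B w := by
  simp [gramWord]

theorem exists_gramWord_transpose (A B : Matrix (Fin n) (Fin n) R) (w : List (Bool × Bool)) :
    ∃ v : List (Bool × Bool), gramWord A B v = (gramWord A B w)ᵀ := by
  induction w with
  | nil => exact ⟨[], by simp [gramWord_nil]⟩
  | cons g w ih =>
    obtain ⟨v, hv⟩ := ih
    refine ⟨v ++ [(g.2, g.1)], ?_⟩
    rw [gramWord_append, hv, gramWord_cons, gramWord_cons, gramWord_nil]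
    simp [Matrix.transpose_mul]

theorem gramWord_map {R' : Type*} [CommRing R'] (f : R →+* R') (A B : Matrix (Fin n) (Fin n) R)
    (w : List (Bool × Bool)) :
    (gramWord A B w).map f = gramWord (A.map f) (B.map f) w := by
  induction w with
  | nil => simp [gramWord_nil]
  | cons g w ih =>
    rw [gramWord_cons, gramWord_cons, Matrix.map_mul, ih, Matrix.map_mul]
    rcases g with ⟨_ | _, _ | _⟩ <;> rfl

variable {A B : Matrix (Fin n) (Fin n) R}

theorem boolMatrix_mul_intertwine (h₁ : A * Aᵀ = B * Bᵀ) (h₂ : Aᵀ * A = Bᵀ * B) (r s t : Bool) :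
    boolMatrix A B r * ((boolMatrix A B s)ᵀ * boolMatrix A B t)ᵀ =
      boolMatrix A B s * (boolMatrix A B t)ᵀ * boolMatrix A B r := by
  have e₁ : B * Bᵀ = A * Aᵀ := h₁.symm
  have e₂ : Bᵀ * B = Aᵀ * A := h₂.symm
  have e₃ : B * (Aᵀ * A) = A * (Aᵀ * B) := by rw [h₂, ← mul_assoc, e₁, mul_assoc]
  have e₄ : A * (Bᵀ * B) = B * (Bᵀ * A) := by rw [e₂, ← mul_assoc, h₁, mul_assoc]
  cases r <;> cases s <;> cases t <;>
    simp [boolMatrix, Matrix.transpose_mul, mul_assoc, e₃, e₄]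

theorem boolMatrix_commute (h₁ : A * Aᵀ = B * Bᵀ) (h₂ : Aᵀ * A = Bᵀ * B) (r s t u : Bool) :
    boolMatrix A B r * (boolMatrix A B s)ᵀ * (boolMatrix A B t * (boolMatrix A B u)ᵀ) =
      boolMatrix A B t * (boolMatrix A B u)ᵀ * (boolMatrix A B r * (boolMatrix A B s)ᵀ) := by
  have h := boolMatrix_mul_intertwine h₁ h₂ r t u
  have h' := boolMatrix_mul_intertwine (A := Aᵀ) (B := Bᵀ) (by simpa using h₂)
    (by simpa using h₁) s u t
  have key : ∀ b, boolMatrix Aᵀ Bᵀ b = (boolMatrix A B b)ᵀ := by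
    intro b; cases b <;> rfl
  simp only [key, Matrix.transpose_mul, Matrix.transpose_transpose] at h h'
  rw [mul_assoc, h', ← mul_assoc, h]
  simp only [mul_assoc]

theorem gramWord_commute (h₁ : A * Aᵀ = B * Bᵀ) (h₂ : Aᵀ * A = Bᵀ * B) (s t : Bool)
    (w : List (Bool × Bool)) :
    boolMatrix A B s * (boolMatrix A B t)ᵀ * gramWord Aᵀ Bᵀ w =
      gramWord Aᵀ Bᵀ w * (boolMatrix A B s * (boolMatrix A B t)ᵀ) := by
  induction w with
  | nil => simp [gramWord_nil]
  | cons g w ih =>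
    rw [gramWord_cons]
    simp only [boolMatrix_transpose_arg, Matrix.transpose_transpose]
    rw [← mul_assoc, boolMatrix_commute h₁ h₂, mul_assoc, ih, mul_assoc, mul_assoc, mul_assoc]

theorem boolMatrix_mul_gramWord_transpose (h₁ : A * Aᵀ = B * Bᵀ) (h₂ : Aᵀ * A = Bᵀ * B)
    (r : Bool) (w : List (Bool × Bool)) :
    boolMatrix A B r * (gramWord A B w)ᵀ = gramWord Aᵀ Bᵀ w * boolMatrix A B r := by
  induction w with
  | nil => simp [gramWord_nil]
  | cons g w ih =>
    rw [gramWord_cons, gramWord_cons, Matrix.transpose_mul, ← mul_assoc, ih, mul_assoc,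
      boolMatrix_mul_intertwine h₁ h₂, ← mul_assoc, ← gramWord_commute h₁ h₂]
    simp only [boolMatrix_transpose_arg, Matrix.transpose_transpose]

/-- Traces of Gram words are invariant under transposing both letters. -/
theorem trace_gramWord_transpose (h₁ : A * Aᵀ = B * Bᵀ) (h₂ : Aᵀ * A = Bᵀ * B)
    (w : List (Bool × Bool)) :
    (gramWord Aᵀ Bᵀ w).trace = (gramWord A B w).trace := by
  cases w with
  | nil => simp [gramWord_nil]
  | cons g w =>
    rw [gramWord_cons, gramWord_cons]
    simp only [boolMatrix_transpose_arg, Matrix.transpose_transpose]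
    rw [← Matrix.trace_transpose (_ * _ * gramWord A B w), Matrix.transpose_mul,
      Matrix.transpose_mul, Matrix.transpose_transpose, ← mul_assoc,
      Matrix.trace_mul_comm (_ * _) (boolMatrix A B g.1), ← mul_assoc (boolMatrix A B g.1),
      boolMatrix_mul_gramWord_transpose h₁ h₂, mul_assoc (gramWord Aᵀ Bᵀ w),
      Matrix.trace_mul_comm (gramWord Aᵀ Bᵀ w)]

end TraceWords

section Tensors

open Matrix

variable {n : ℕ} {S : Type*} [CommRing S]

/-- The infinitesimal rotation in the `(p, q)`-plane. -/
def planeRotation (S : Type*) [CommRing S] (p q : Fin n) : Matrix (Fin n) (Fin n) S :=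
  Matrix.single q p 1 - Matrix.single p q 1

/-- The reflection in the `p`-th coordinate. -/
def coordReflection (S : Type*) [CommRing S] (p : Fin n) : Matrix (Fin n) (Fin n) S :=
  Matrix.diagonal fun i => if i = p then -1 else 1

theorem planeRotation_transpose (p q : Fin n) :
    (planeRotation S p q)ᵀ = -planeRotation S p q := by
  simp [planeRotation, Matrix.transpose_single]

theorem coordReflection_transpose (p : Fin n) :
    (coordReflection S p)ᵀ = coordReflection S p := by
  simp [coordReflection]

theorem coordReflection_mul_self (p : Fin n) :
    coordReflection S p * coordReflection S p = 1 := by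
  rw [coordReflection, Matrix.diagonal_mul_diagonal, ← Matrix.diagonal_one]
  congr 1
  ext i
  split_ifs <;> simp

theorem mul_planeRotation_apply (M : Matrix (Fin n) (Fin n) S) (p q i j : Fin n) :
    (M * planeRotation S p q) i j =
      (if j = p then M i q else 0) - (if j = q then M i p else 0) := by
  simp only [planeRotation, mul_sub, Matrix.sub_apply]
  congr 1 <;> simp only [Matrix.mul_apply, Matrix.single_apply, mul_ite, mul_one, mul_zero] <;>
    · split_ifs with h
      · subst h; simp
      · simp [Ne.symm h]

theorem planeRotation_mul_apply (M : Matrix (Fin n) (Fin n) S) (p q i j : Fin n) :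
    (planeRotation S p q * M) i j =
      (if i = q then M p j else 0) - (if i = p then M q j else 0) := by
  simp only [planeRotation, sub_mul, Matrix.sub_apply]
  congr 1 <;> simp only [Matrix.mul_apply, Matrix.single_apply, ite_mul, one_mul, zero_mul] <;>
    · split_ifs with h
      · subst h; simp
      · simp [Ne.symm h]

theorem prod_update_fst {E β : Type*} [Fintype E] [DecidableEq E] [DecidableEq β]
    (v : E → (β → Fin n) → S) (i : E × β → Fin n) (e : E) (b : β) (x : Fin n) :
    ∏ e', v e' (fun b' => Function.update i (e, b) x (e', b')) =
      (∏ e' ∈ Finset.univ.erase e, v e' fun b' => i (e', b')) *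
        v e (Function.update (fun b' => i (e, b')) b x) := by
  rw [← Finset.mul_prod_erase _ _ (Finset.mem_univ e), mul_comm]
  congr 1
  · refine Finset.prod_congr rfl fun e' he' => ?_
    congr 1
    ext b'
    rw [Function.update_of_ne]
    intro h
    exact Finset.ne_of_mem_erase he' (congrArg Prod.fst h)
  · congr 1
    ext b'
    by_cases h : b' = b
    · subst h; simp
    · rw [Function.update_of_ne h, Function.update_of_ne]
      intro h'
      exact h (congrArg Prod.snd h')

variable [Algebra ℝ S]

theorem Derivation.map_finset_prod {E : Type*} [DecidableEq E] (D : Derivation ℝ S S)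
    (s : Finset E) (f : E → S) :
    D (∏ e ∈ s, f e) = ∑ e ∈ s, (∏ x ∈ s.erase e, f x) * D (f e) := by
  induction s using Finset.induction_on with
  | empty => simp
  | insert a s ha ih =>
    rw [Finset.prod_insert ha, Derivation.leibniz, ih, Finset.sum_insert ha,
      Finset.erase_insert ha, smul_eq_mul, smul_eq_mul, Finset.mul_sum, add_comm]
    congr 1
    refine Finset.sum_congr rfl fun e he => ?_
    have hne : a ≠ e := fun h => ha (h ▸ he)
    rw [Finset.erase_insert_of_ne hne, Finset.prod_insert
      (fun h => ha (Finset.mem_of_mem_erase h)), mul_assoc]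

/-- A family indexed by multi-indices which transforms like a tensor under a family `D` of
infinitesimal rotations and a family `r` of coordinate reflections. -/
structure IsTensor (D : Fin n → Fin n → Derivation ℝ S S) (r : Fin n → S →ₐ[ℝ] S)
    {P : Type*} [Fintype P] [DecidableEq P] (u : (P → Fin n) → S) : Prop where
  deriv : ∀ p q i, D p q (u i) =
    ∑ s, ((if i s = p then u (Function.update i s q) else 0) -
      (if i s = q then u (Function.update i s p) else 0))
  refl : ∀ p i, r p (u i) = (∏ s, if i s = p then (-1 : S) else 1) * u i

/-- Elements fixed by the infinitesimal rotations and reflections. -/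
structure IsInvariantElem (D : Fin n → Fin n → Derivation ℝ S S) (r : Fin n → S →ₐ[ℝ] S)
    (c : S) : Prop where
  deriv : ∀ p q, D p q c = 0
  refl : ∀ p, r p c = c

variable {D : Fin n → Fin n → Derivation ℝ S S} {r : Fin n → S →ₐ[ℝ] S}

theorem IsInvariantElem.one : IsInvariantElem D r (1 : S) :=
  ⟨fun p q => by simp, fun p => by simp⟩

theorem IsInvariantElem.mul {c d : S} (hc : IsInvariantElem D r c) (hd : IsInvariantElem D r d) :
    IsInvariantElem D r (c * d) :=
  ⟨fun p q => by simp [hc.deriv, hd.deriv], fun p => by simp [hc.refl, hd.refl]⟩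

theorem IsTensor.const_mul {P : Type*} [Fintype P] [DecidableEq P] {u : (P → Fin n) → S} {c : S}
    (hc : IsInvariantElem D r c) (hu : IsTensor D r u) : IsTensor D r fun i => c * u i := by
  refine ⟨fun p q i => ?_, fun p i => ?_⟩
  · rw [Derivation.leibniz, hc.deriv, hu.deriv, smul_zero, add_zero, smul_eq_mul, Finset.mul_sum]
    refine Finset.sum_congr rfl fun s _ => ?_
    split_ifs <;> ring
  · rw [map_mul, hc.refl, hu.refl]; ring

theorem IsTensor.prod {E β : Type*} [Fintype E] [DecidableEq E] [Fintype β] [DecidableEq β]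
    {v : E → (β → Fin n) → S} (hv : ∀ e, IsTensor D r (v e)) :
    IsTensor D r fun i : E × β → Fin n => ∏ e, v e fun b => i (e, b) := by
  refine ⟨fun p q i => ?_, fun p i => ?_⟩
  · rw [Derivation.map_finset_prod, Fintype.sum_prod_type]
    refine Finset.sum_congr rfl fun e _ => ?_
    rw [(hv e).deriv, Finset.mul_sum]
    refine Finset.sum_congr rfl fun b _ => ?_
    simp only [prod_update_fst]
    split_ifs <;> ring
  · rw [map_prod, Fintype.prod_prod_type, ← Finset.prod_mul_distrib]
    exact Finset.prod_congr rfl fun e _ => (hv e).refl p _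

theorem map_derivation_mul (d : Derivation ℝ S S) (M N : Matrix (Fin n) (Fin n) S) :
    (M * N).map d = M.map d * N + M * N.map d := by
  ext i j
  simp only [Matrix.map_apply, Matrix.mul_apply, Matrix.add_apply, map_sum, Derivation.leibniz,
    smul_eq_mul, Finset.sum_add_distrib]
  rw [add_comm]
  congr 1
  exact Finset.sum_congr rfl fun k _ => mul_comm _ _

variable {A B : Matrix (Fin n) (Fin n) S}

theorem gramWord_map_derivation_right {d : Derivation ℝ S S} {K : Matrix (Fin n) (Fin n) S}
    (hK : Kᵀ = -K) (h : ∀ b, (boolMatrix A B b).map d = boolMatrix A B b * K)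
    (w : List (Bool × Bool)) :
    (gramWord A B w).map d = gramWord A B w * K - K * gramWord A B w := by
  induction w with
  | nil =>
    rw [gramWord_nil, mul_one, one_mul, sub_self]
    ext i j
    by_cases hij : i = j <;> simp [hij]
  | cons g w ih =>
    have ht : ∀ b, (boolMatrix A B b)ᵀ.map d = -K * (boolMatrix A B b)ᵀ := fun b => by
      rw [Matrix.transpose_map, h, Matrix.transpose_mul, hK]
    rw [gramWord_cons, map_derivation_mul, map_derivation_mul, ih, h, ht]
    noncomm_ring

theorem gramWord_map_derivation_left {d : Derivation ℝ S S} {K : Matrix (Fin n) (Fin n) S}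
    (hK : Kᵀ = -K) (h : ∀ b, (boolMatrix A B b).map d = Kᵀ * boolMatrix A B b)
    (w : List (Bool × Bool)) : (gramWord A B w).map d = 0 := by
  induction w with
  | nil =>
    rw [gramWord_nil]
    ext i j
    by_cases hij : i = j <;> simp [hij]
  | cons g w ih =>
    have ht : ∀ b, (boolMatrix A B b)ᵀ.map d = (boolMatrix A B b)ᵀ * K := fun b => by
      rw [Matrix.transpose_map, h, Matrix.transpose_mul, Matrix.transpose_transpose]
    rw [gramWord_cons, map_derivation_mul, map_derivation_mul, ih, h, ht, hK]
    noncomm_ring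

theorem gramWord_map_reflection_right {f : S →ₐ[ℝ] S} {K : Matrix (Fin n) (Fin n) S}
    (hK : Kᵀ = K) (hKK : K * K = 1) (h : ∀ b, (boolMatrix A B b).map f = boolMatrix A B b * K)
    (w : List (Bool × Bool)) :
    (gramWord A B w).map f = K * gramWord A B w * K := by
  induction w with
  | nil => simp [gramWord_nil, hKK]
  | cons g w ih =>
    have ht : ∀ b, (boolMatrix A B b)ᵀ.map f = K * (boolMatrix A B b)ᵀ := fun b => by
      rw [Matrix.transpose_map, h, Matrix.transpose_mul, hK]
    have e : ∀ X, K * (K * X) = X := fun X => by rw [← mul_assoc, hKK, one_mul]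
    rw [gramWord_cons, Matrix.map_mul, Matrix.map_mul, ih, h, ht]
    simp only [mul_assoc, e]

theorem gramWord_map_reflection_left {f : S →ₐ[ℝ] S} {K : Matrix (Fin n) (Fin n) S}
    (hK : Kᵀ = K) (hKK : K * K = 1) (h : ∀ b, (boolMatrix A B b).map f = K * boolMatrix A B b)
    (w : List (Bool × Bool)) :
    (gramWord A B w).map f = gramWord A B w := by
  induction w with
  | nil => simp [gramWord_nil]
  | cons g w ih =>
    have ht : ∀ b, (boolMatrix A B b)ᵀ.map f = (boolMatrix A B b)ᵀ * K := fun b => by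
      rw [Matrix.transpose_map, h, Matrix.transpose_mul, hK]
    have e : ∀ X, K * (K * X) = X := fun X => by rw [← mul_assoc, hKK, one_mul]
    rw [gramWord_cons, Matrix.map_mul, Matrix.map_mul, ih, h, ht]
    simp only [mul_assoc, e]

/-- Entries of a matrix on which rotations act by commutator form a tensor of rank two. -/
theorem isTensor_bool {N : Matrix (Fin n) (Fin n) S}
    (hD : ∀ p q, N.map (D p q) = N * planeRotation S p q - planeRotation S p q * N)
    (hr : ∀ p, N.map (r p) = coordReflection S p * N * coordReflection S p) :
    IsTensor D r fun i : Bool → Fin n => N (i false) (i true) := by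
  refine ⟨fun p q i => ?_, fun p i => ?_⟩
  · have := congrFun (congrFun (hD p q) (i false)) (i true)
    rw [Matrix.map_apply, Matrix.sub_apply, mul_planeRotation_apply,
      planeRotation_mul_apply] at this
    rw [this]
    simp
    ring
  · have := congrFun (congrFun (hr p) (i false)) (i true)
    rw [Matrix.map_apply, coordReflection, Matrix.mul_diagonal, Matrix.diagonal_mul] at this
    rw [this, mul_right_comm, mul_comm]
    simp [mul_comm]

/-- Entries in a fixed column of a matrix on which rotations act from the left form a vector. -/
theorem isTensor_unit {N : Matrix (Fin n) (Fin n) S}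
    (hD : ∀ p q, N.map (D p q) = (planeRotation S p q)ᵀ * N)
    (hr : ∀ p, N.map (r p) = coordReflection S p * N) (j : Fin n) :
    IsTensor D r fun i : Unit → Fin n => N (i ()) j := by
  refine ⟨fun p q i => ?_, fun p i => ?_⟩
  · have := congrFun (congrFun (hD p q) (i ())) j
    rw [Matrix.map_apply, planeRotation_transpose, neg_mul, Matrix.neg_apply,
      planeRotation_mul_apply] at this
    rw [this]
    simp
  · have := congrFun (congrFun (hr p) (i ())) j
    rw [Matrix.map_apply, coordReflection, Matrix.diagonal_mul] at this
    rw [this]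
    simp

/-- First main step of Brauer's invariant theory: an invariant functional which kills the
contractions of a tensor kills the tensor. -/
theorem IsTensor.functional_eq_zero {P : Type} [Fintype P] [DecidableEq P] [Nonempty P]
    {u : (P → Fin n) → S} (hu : IsTensor D r u) (Λ : S →ₗ[ℝ] ℝ)
    (hD : ∀ p q x, Λ (D p q x) = 0) (hr : ∀ p x, Λ (r p x) = Λ x)
    (hc : ∀ s s' i, s ≠ s' →
      Λ (∑ c, u (Function.update (Function.update i s c) s' c)) = 0) (i : P → Fin n) :
    Λ (u i) = 0 := by
  refine congrFun (orthogonal_invariant_traceless_eq_zero (fun i => Λ (u i)) ?_ ?_ ?_) i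
  · intro p q i
    have h := hD p q (u i)
    rw [hu.deriv, Finset.sum_sub_distrib, map_sub, sub_eq_zero, map_sum, map_sum] at h
    simpa only [apply_ite Λ, map_zero] using h
  · intro p i
    have h := hr p (u i)
    rw [hu.refl] at h
    conv_lhs => rw [← h]
    have : (∏ s, if i s = p then (-1 : S) else 1) =
        algebraMap ℝ S (∏ s, if i s = p then (-1 : ℝ) else 1) := by
      rw [map_prod]
      refine Finset.prod_congr rfl fun s _ => ?_
      split_ifs <;> simp
    rw [this, ← Algebra.smul_def, map_smul, smul_eq_mul]
  · intro s s' i h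
    rw [← map_sum]
    exact hc s s' i h

end Tensors

section Vanishing

open Matrix

variable {n : ℕ} {S : Type*} [CommRing S] [Algebra ℝ S]
variable {D : Fin n → Fin n → Derivation ℝ S S} {r : Fin n → S →ₐ[ℝ] S}
variable {A B : Matrix (Fin n) (Fin n) S}

theorem isInvariantElem_trace {N : Matrix (Fin n) (Fin n) S}
    (hD : ∀ p q, N.map (D p q) = N * planeRotation S p q - planeRotation S p q * N)
    (hr : ∀ p, N.map (r p) = coordReflection S p * N * coordReflection S p) :
    IsInvariantElem D r N.trace := by
  refine ⟨fun p q => ?_, fun p => ?_⟩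
  · have : D p q N.trace = (N.map (D p q)).trace := by simp [Matrix.trace, map_sum]
    rw [this, hD, Matrix.trace_sub, Matrix.trace_mul_comm, sub_self]
  · have : r p N.trace = (N.map (r p)).trace := by simp [Matrix.trace, map_sum]
    rw [this, hr, Matrix.trace_mul_comm, ← mul_assoc, coordReflection_mul_self, one_mul]

theorem map_trace_gramWord_sub_mem {I : Ideal S} {τ : S →ₐ[ℝ] S}
    (h₁ : ∀ i j, (A * Aᵀ - B * Bᵀ) i j ∈ I) (h₂ : ∀ i j, (Aᵀ * A - Bᵀ * B) i j ∈ I)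
    (hτA : A.map τ = Aᵀ) (hτB : B.map τ = Bᵀ) (w : List (Bool × Bool)) :
    τ (gramWord A B w).trace - (gramWord A B w).trace ∈ I := by
  have e : τ (gramWord A B w).trace = (gramWord Aᵀ Bᵀ w).trace := by
    rw [← hτA, ← hτB]
    have := gramWord_map (τ : S →+* S) A B w
    simp only [RingHom.coe_coe] at this
    rw [← this]
    simp [Matrix.trace, map_sum]
  rw [e, ← Ideal.Quotient.eq]
  let π := Ideal.Quotient.mk I
  have tr : ∀ N : Matrix (Fin n) (Fin n) S, π N.trace = (N.map π).trace := fun N => by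
    simp [Matrix.trace, map_sum]
  change π _ = π _
  rw [tr, tr, gramWord_map, gramWord_map, Matrix.transpose_map, Matrix.transpose_map]
  apply trace_gramWord_transpose
  · ext i j
    have := Ideal.Quotient.eq_zero_iff_mem.2 (h₁ i j)
    rw [Matrix.sub_apply, map_sub, sub_eq_zero] at this
    rw [← Matrix.transpose_map, ← Matrix.transpose_map, ← Matrix.map_mul, ← Matrix.map_mul]
    exact this
  · ext i j
    have := Ideal.Quotient.eq_zero_iff_mem.2 (h₂ i j)
    rw [Matrix.sub_apply, map_sub, sub_eq_zero] at this
    rw [← Matrix.transpose_map, ← Matrix.transpose_map, ← Matrix.map_mul, ← Matrix.map_mul]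
    exact this

theorem prod_subtype_ne {E : Type*} [Fintype E] [DecidableEq E] {M : Type*} [CommMonoid M]
    (e : E) (f : E → M) : ∏ y : {y : E // y ≠ e}, f y = ∏ y ∈ Finset.univ.erase e, f y :=
  (Finset.prod_subtype (Finset.univ.erase e) (by simp) f).symm

/-- An invariant functional which is odd under transposition and kills the moment ideal kills
all products of invariants and entries of Gram words. -/
theorem functional_prod_gramWord_eq_zero {I : Ideal S} {τ : S →ₐ[ℝ] S} {Λ : S →ₗ[ℝ] ℝ}
    (hI : ∀ x ∈ I, Λ x = 0) (hτ : ∀ x, Λ (τ x) = -Λ x)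
    (h₁ : ∀ i j, (A * Aᵀ - B * Bᵀ) i j ∈ I) (h₂ : ∀ i j, (Aᵀ * A - Bᵀ * B) i j ∈ I)
    (hτA : A.map τ = Aᵀ) (hτB : B.map τ = Bᵀ)
    (hD : ∀ p q b, (boolMatrix A B b).map (D p q) = boolMatrix A B b * planeRotation S p q)
    (hr : ∀ p b, (boolMatrix A B b).map (r p) = boolMatrix A B b * coordReflection S p)
    (hΛD : ∀ p q x, Λ (D p q x) = 0) (hΛr : ∀ p x, Λ (r p x) = Λ x) (k : ℕ) :
    ∀ (E : Type) [Fintype E] [DecidableEq E], Fintype.card E = k → ∀ c : S,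
      IsInvariantElem D r c → τ c - c ∈ I → ∀ (w : E → List (Bool × Bool)) (i : E × Bool → Fin n),
      Λ (c * ∏ e, gramWord A B (w e) (i (e, false)) (i (e, true))) = 0 := by
  have hND := fun w p q => gramWord_map_derivation_right (planeRotation_transpose p q) (hD p q) w
  have hNr := fun w p => gramWord_map_reflection_right (coordReflection_transpose p)
    (coordReflection_mul_self p) (hr p) w
  induction k with
  | zero =>
    intro E _ _ hE c _ hc w i
    have := Fintype.card_eq_zero_iff.1 hE
    have h := hI _ hc
    rw [map_sub, hτ] at h
    rw [Finset.univ_eq_empty, Finset.prod_empty, mul_one]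
    linarith
  | succ k ih =>
    intro E _ _ hE c hc hc' w i
    have : Nonempty E := Fintype.card_pos_iff.1 (by omega)
    have hcard : ∀ e : E, Fintype.card {y : E // y ≠ e} = k := fun e => by
      rw [Fintype.card_subtype_compl, Fintype.card_subtype_eq]; omega
    have hu : IsTensor D r fun i : E × Bool → Fin n =>
        c * ∏ e, gramWord A B (w e) (i (e, false)) (i (e, true)) :=
      IsTensor.const_mul hc (IsTensor.prod
        (v := fun e (i : Bool → Fin n) => gramWord A B (w e) (i false) (i true))
        fun e => isTensor_bool (fun p q => hND (w e) p q) fun p => hNr (w e) p)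
    refine hu.functional_eq_zero Λ hΛD hΛr ?_ i
    rintro ⟨e, b⟩ ⟨e', b'⟩ i hs
    have hother : ∀ y, y ≠ e → y ≠ e' → ∀ x t,
        Function.update (Function.update i (e, b) x) (e', b') x (y, t) = i (y, t) := by
      intro y hy hy' x t
      rw [Function.update_of_ne (fun h => hy' (congrArg Prod.fst h)),
        Function.update_of_ne (fun h => hy (congrArg Prod.fst h))]
    by_cases hee : e = e'
    · subst hee
      have hall : ∀ x t, Function.update (Function.update i (e, b) x) (e, b') x (e, t) = x := by
        intro x t
        by_cases ht : t = b'
        · subst ht; simp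
        · have : t = b := by
            have : b ≠ b' := fun h => hs (by rw [h])
            cases t <;> cases b <;> cases b' <;> simp_all
          subst this
          rw [Function.update_of_ne hs, Function.update_self]
      have h := ih {y : E // y ≠ e} (hcard e) (c * (gramWord A B (w e)).trace)
        (hc.mul (isInvariantElem_trace (hND _) (hNr _))) (by
          have h := map_trace_gramWord_sub_mem h₁ h₂ hτA hτB (w e)
          have : τ (c * (gramWord A B (w e)).trace) - c * (gramWord A B (w e)).trace =
            τ c * (τ (gramWord A B (w e)).trace - (gramWord A B (w e)).trace) +
            (gramWord A B (w e)).trace * (τ c - c) := by rw [map_mul]; ring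
          rw [this]
          exact I.add_mem (I.mul_mem_left _ h) (I.mul_mem_left _ hc'))
        (fun y => w y) (fun y => i (y.1, y.2))
      rw [prod_subtype_ne e fun y => gramWord A B (w y) (i (y, false)) (i (y, true))] at h
      rw [← h]
      congr 1
      rw [mul_assoc, Matrix.trace, Finset.sum_mul, Finset.mul_sum]
      refine Finset.sum_congr rfl fun x _ => ?_
      congr 1
      rw [← Finset.mul_prod_erase _ _ (Finset.mem_univ e), hall, hall, Matrix.diag_apply]
      congr 1
      refine Finset.prod_congr rfl fun y hy => ?_
      rw [hother y (Finset.ne_of_mem_erase hy) (Finset.ne_of_mem_erase hy),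
        hother y (Finset.ne_of_mem_erase hy) (Finset.ne_of_mem_erase hy)]
    · obtain ⟨v, hv⟩ : ∃ v, ∀ x, gramWord A B (w e)
          (Function.update (Function.update i (e, b) x) (e', b') x (e, false))
          (Function.update (Function.update i (e, b) x) (e', b') x (e, true)) =
          gramWord A B v (i (e, !b)) x := by
        cases b
        · obtain ⟨v, hv⟩ := exists_gramWord_transpose A B (w e)
          exact ⟨v, fun x => by simp [hv, hee]⟩
        · exact ⟨w e, fun x => by simp [hee]⟩
      obtain ⟨v', hv'⟩ : ∃ v', ∀ x, gramWord A B (w e')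
          (Function.update (Function.update i (e, b) x) (e', b') x (e', false))
          (Function.update (Function.update i (e, b) x) (e', b') x (e', true)) =
          gramWord A B v' x (i (e', !b')) := by
        cases b'
        · exact ⟨w e', fun x => by simp [Ne.symm hee]⟩
        · obtain ⟨v, hv⟩ := exists_gramWord_transpose A B (w e')
          exact ⟨v, fun x => by simp [hv, Ne.symm hee]⟩
      have h := ih {y : E // y ≠ e} (hcard e) c hc hc'
        (fun y => if y.1 = e' then v ++ v' else w y)
        (fun y => if y.1.1 = e' then (if y.2 then i (e', !b') else i (e, !b)) else i (y.1, y.2))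
      rw [prod_subtype_ne e fun y => gramWord A B (if y = e' then v ++ v' else w y)
        (if y = e' then (if false then i (e', !b') else i (e, !b)) else i (y, false))
        (if y = e' then (if true then i (e', !b') else i (e, !b)) else i (y, true)),
        ← Finset.mul_prod_erase _ _ (Finset.mem_erase.2 ⟨Ne.symm hee, Finset.mem_univ e'⟩)] at h
      rw [← h]
      congr 1
      simp only [if_true, Bool.false_eq_true, if_false]
      rw [gramWord_append, Matrix.mul_apply, Finset.sum_mul, Finset.mul_sum]
      refine Finset.sum_congr rfl fun x _ => ?_
      rw [← Finset.mul_prod_erase _ _ (Finset.mem_univ e),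
        ← Finset.mul_prod_erase _ _ (Finset.mem_erase.2 ⟨Ne.symm hee, Finset.mem_univ e'⟩),
        hv, hv', mul_assoc (gramWord A B v _ _)]
      congr 3
      refine Finset.prod_congr rfl fun y hy => ?_
      have hy' := Finset.ne_of_mem_erase hy
      have hy'' := Finset.ne_of_mem_erase (Finset.mem_of_mem_erase hy)
      rw [hother y hy'' hy', hother y hy'' hy', if_neg hy', if_neg hy', if_neg hy']

end Vanishing

section FirstFundamental

open Matrix

variable {n : ℕ} {S : Type*} [CommRing S]
variable {A B : Matrix (Fin n) (Fin n) S}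

theorem prod_subtype_ne_ne {E : Type*} [Fintype E] [DecidableEq E] {M : Type*} [CommMonoid M]
    (e e' : E) (f : E → M) : ∏ y : {y : E // y ≠ e ∧ y ≠ e'}, f y =
      ∏ y ∈ (Finset.univ.erase e).erase e', f y :=
  (Finset.prod_subtype ((Finset.univ.erase e).erase e') (by simp [and_comm]) f).symm

/-- The monoid of products of entries of Gram words. -/
def gramMonoid (A B : Matrix (Fin n) (Fin n) S) : Submonoid S :=
  Submonoid.closure {x | ∃ w i j, x = gramWord A B w i j}

theorem exists_prod_gramWord_of_mem {x : S} (hx : x ∈ gramMonoid A B) :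
    ∃ (k : ℕ) (w : Fin k → List (Bool × Bool)) (i : Fin k × Bool → Fin n),
      x = ∏ e, gramWord A B (w e) (i (e, false)) (i (e, true)) := by
  obtain ⟨l, hl, rfl⟩ := Submonoid.exists_list_of_mem_closure hx
  choose w i j h using hl
  refine ⟨l.length, fun e => w _ (List.get_mem l e), fun p =>
    if p.2 then j _ (List.get_mem l p.1) else i _ (List.get_mem l p.1), ?_⟩
  conv_lhs => rw [← List.ofFn_get l, List.prod_ofFn]
  refine Finset.prod_congr rfl fun e _ => ?_
  simpa using h _ (List.get_mem l e)

variable [Algebra ℝ S]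

theorem isInvariantElem_of_mem_closure {D : Fin n → Fin n → Derivation ℝ S S}
    {r : Fin n → S →ₐ[ℝ] S} {s : Set S} (hs : ∀ x ∈ s, IsInvariantElem D r x) {x : S}
    (hx : x ∈ Submonoid.closure s) : IsInvariantElem D r x := by
  induction hx using Submonoid.closure_induction with
  | mem x hx => exact hs x hx
  | one => exact IsInvariantElem.one
  | mul x y _ _ hx hy => exact hx.mul hy

theorem functional_mul_prod_entries_eq_zero {Λ : S →ₗ[ℝ] ℝ}
    {D : Fin n → Fin n → Derivation ℝ S S} {r : Fin n → S →ₐ[ℝ] S}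
    (hD : ∀ p q b, (boolMatrix A B b).map (D p q) = (planeRotation S p q)ᵀ * boolMatrix A B b)
    (hr : ∀ p b, (boolMatrix A B b).map (r p) = coordReflection S p * boolMatrix A B b)
    (hΛD : ∀ p q x, Λ (D p q x) = 0) (hΛr : ∀ p x, Λ (r p x) = Λ x)
    (hΛ : ∀ x ∈ gramMonoid A B, Λ x = 0) (k : ℕ) :
    ∀ (E : Type) [Fintype E] [DecidableEq E], Fintype.card E ≤ k → ∀ x ∈ gramMonoid A B,
      ∀ (b : E → Bool) (i : E × Unit → Fin n) (j : E → Fin n),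
      Λ (x * ∏ e, boolMatrix A B (b e) (i (e, ())) (j e)) = 0 := by
  have hinv : ∀ x ∈ gramMonoid A B, IsInvariantElem D r x := by
    refine fun x => isInvariantElem_of_mem_closure ?_
    rintro _ ⟨w, i, j, rfl⟩
    refine ⟨fun p q => ?_, fun p => ?_⟩
    · exact congrFun (congrFun (gramWord_map_derivation_left (planeRotation_transpose p q)
        (hD p q) w) i) j
    · exact congrFun (congrFun (gramWord_map_reflection_left (coordReflection_transpose p)
        (coordReflection_mul_self p) (hr p) w) i) j
  induction k with
  | zero =>
    intro E _ _ hE x hx b i j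
    have := Fintype.card_eq_zero_iff.1 (Nat.le_zero.1 hE)
    simpa using hΛ x hx
  | succ k ih =>
    intro E _ _ hE x hx b i j
    rcases isEmpty_or_nonempty E with hem | hne
    · simpa using hΛ x hx
    have hu : IsTensor D r fun i : E × Unit → Fin n =>
        x * ∏ e, boolMatrix A B (b e) (i (e, ())) (j e) :=
      IsTensor.const_mul (hinv x hx) (IsTensor.prod
        (v := fun e (i : Unit → Fin n) => boolMatrix A B (b e) (i ()) (j e))
        fun e => isTensor_unit (fun p q => hD p q (b e)) (fun p => hr p (b e)) (j e))
    refine hu.functional_eq_zero Λ hΛD hΛr ?_ i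
    rintro ⟨e, ⟨⟩⟩ ⟨e', ⟨⟩⟩ i hs
    have hee : e' ≠ e := fun h => hs (by rw [h])
    have hcard : Fintype.card {y : E // y ≠ e ∧ y ≠ e'} ≤ k := by
      have : Fintype.card {y : E // y ≠ e ∧ y ≠ e'} < Fintype.card E :=
        Fintype.card_subtype_lt (x := e) (by simp)
      omega
    have h := ih {y : E // y ≠ e ∧ y ≠ e'} hcard
      (x * gramWord A B [(b e, b e')] (j e) (j e'))
      (mul_mem hx (Submonoid.subset_closure ⟨_, _, _, rfl⟩))
      (fun y => b y) (fun y => i (y.1, ())) (fun y => j y)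
    rw [prod_subtype_ne_ne e e' fun y => boolMatrix A B (b y) (i (y, ())) (j y)] at h
    rw [← h]
    congr 1
    rw [gramWord_cons, gramWord_nil, mul_one, Matrix.mul_apply, mul_assoc, Finset.sum_mul,
      Finset.mul_sum]
    refine Finset.sum_congr rfl fun c _ => ?_
    rw [← Finset.mul_prod_erase _ _ (Finset.mem_univ e),
      ← Finset.mul_prod_erase _ _ (Finset.mem_erase.2 ⟨hee, Finset.mem_univ e'⟩), ← mul_assoc
        (boolMatrix A B (b e) _ _)]
    congr 2
    · simp [Ne.symm hee]
    · refine Finset.prod_congr rfl fun y hy => ?_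
      have hy' := Finset.ne_of_mem_erase hy
      have hy'' := Finset.ne_of_mem_erase (Finset.mem_of_mem_erase hy)
      simp [hy', hy'']

/-- A functional on the algebra generated by two matrices which is invariant under rotations and
reflections on both sides, odd under transposition, and kills the moment ideal, is zero. -/
theorem functional_eq_zero_of_odd {I : Ideal S} {τ : S →ₐ[ℝ] S} {Λ : S →ₗ[ℝ] ℝ}
    {Dl Dr : Fin n → Fin n → Derivation ℝ S S} {rl rr : Fin n → S →ₐ[ℝ] S}
    (hgen : Algebra.adjoin ℝ {x | ∃ b i j, x = boolMatrix A B b i j} = ⊤)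
    (hI : ∀ x ∈ I, Λ x = 0) (hτ : ∀ x, Λ (τ x) = -Λ x)
    (h₁ : ∀ i j, (A * Aᵀ - B * Bᵀ) i j ∈ I) (h₂ : ∀ i j, (Aᵀ * A - Bᵀ * B) i j ∈ I)
    (hτA : A.map τ = Aᵀ) (hτB : B.map τ = Bᵀ)
    (hDr : ∀ p q b, (boolMatrix A B b).map (Dr p q) = boolMatrix A B b * planeRotation S p q)
    (hrr : ∀ p b, (boolMatrix A B b).map (rr p) = boolMatrix A B b * coordReflection S p)
    (hDl : ∀ p q b, (boolMatrix A B b).map (Dl p q) = (planeRotation S p q)ᵀ * boolMatrix A B b)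
    (hrl : ∀ p b, (boolMatrix A B b).map (rl p) = coordReflection S p * boolMatrix A B b)
    (hΛDr : ∀ p q x, Λ (Dr p q x) = 0) (hΛrr : ∀ p x, Λ (rr p x) = Λ x)
    (hΛDl : ∀ p q x, Λ (Dl p q x) = 0) (hΛrl : ∀ p x, Λ (rl p x) = Λ x) : Λ = 0 := by
  have key : ∀ x ∈ gramMonoid A B, Λ x = 0 := by
    intro x hx
    obtain ⟨k, w, i, rfl⟩ := exists_prod_gramWord_of_mem hx
    simpa using functional_prod_gramWord_eq_zero hI hτ h₁ h₂ hτA hτB hDr hrr hΛDr hΛrr k (Fin k)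
      (by simp) 1 IsInvariantElem.one (by simp) w i
  have hspan : Submodule.span ℝ (Submonoid.closure {x | ∃ b i j, x = boolMatrix A B b i j} : Set S)
      = ⊤ := by
    rw [← Algebra.adjoin_eq_span, hgen, Algebra.top_toSubmodule]
  refine LinearMap.ext_on hspan fun x hx => ?_
  obtain ⟨l, hl, rfl⟩ := Submonoid.exists_list_of_mem_closure hx
  choose b i j h using hl
  have := functional_mul_prod_entries_eq_zero hDl hrl hΛDl hΛrl key l.length (Fin l.length)
    (by simp) 1 (one_mem _) (fun e => b _ (List.get_mem l e))
    (fun e => i _ (List.get_mem l e.1)) (fun e => j _ (List.get_mem l e))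
  rw [one_mul] at this
  rw [← List.ofFn_get l, List.prod_ofFn, LinearMap.zero_apply, ← this]
  congr 1
  exact Finset.prod_congr rfl fun e _ => h _ (List.get_mem l e)

end FirstFundamental

section PairPolynomials

open Matrix

open MvPolynomial

theorem MvPolynomial.IsHomogeneous.mkDerivation {R σ : Type*} [CommRing R]
    {f : σ → MvPolynomial σ R} (hf : ∀ i, (f i).IsHomogeneous 1) {φ : MvPolynomial σ R} {m : ℕ}
    (hφ : φ.IsHomogeneous m) : (MvPolynomial.mkDerivation R f φ).IsHomogeneous m := by
  rw [φ.as_sum, map_sum]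
  refine IsHomogeneous.sum _ _ _ fun s hs => ?_
  rw [mkDerivation_monomial, ← mem_homogeneousSubmodule]
  refine Submodule.smul_mem _ _ (Submodule.sum_mem _ fun i hi => ?_)
  rw [mem_homogeneousSubmodule]
  change (monomial _ _ • f i).IsHomogeneous m
  rw [smul_eq_mul]
  have hdeg : s.degree = m := by
    rw [Finsupp.degree_eq_weight_one]
    exact hφ (mem_support_iff.1 hs)
  have hle : Finsupp.single i 1 ≤ s := by
    simpa [Nat.one_le_iff_ne_zero] using Finsupp.mem_support_iff.1 hi
  have hsub : (s - Finsupp.single i 1).degree + 1 = m := by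
    rw [← hdeg]
    conv_rhs => rw [← tsub_add_cancel_of_le hle]
    simp
  rw [← hsub]
  exact (isHomogeneous_monomial _ rfl).mul (hf i)

theorem MvPolynomial.homogeneousComponent_comm {R σ : Type*} [CommRing R]
    (f : MvPolynomial σ R →ₗ[R] MvPolynomial σ R) (k : ℕ)
    (hf : ∀ m φ, φ.IsHomogeneous m → (f φ).IsHomogeneous (m + k)) (d : ℕ) (φ : MvPolynomial σ R) :
    homogeneousComponent (d + k) (f φ) = f (homogeneousComponent d φ) := by
  conv_lhs => rw [← sum_homogeneousComponent φ, map_sum, map_sum]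
  have h : ∀ i, homogeneousComponent (d + k) (f (homogeneousComponent i φ)) =
      if d = i then f (homogeneousComponent d φ) else 0 := by
    intro i
    rw [homogeneousComponent_of_mem (hf i _ (homogeneousComponent_isHomogeneous i φ))]
    by_cases hdi : d = i
    · simp [hdi]
    · simp [hdi]
  simp only [h]
  rw [Finset.sum_ite_eq]
  split_ifs with hd
  · rfl
  · rw [homogeneousComponent_eq_zero _ _ (by simpa using hd), map_zero]

theorem MvPolynomial.homogeneousComponent_of_lt {R σ : Type*} [CommRing R]
    (f : MvPolynomial σ R →ₗ[R] MvPolynomial σ R) (k : ℕ)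
    (hf : ∀ m φ, φ.IsHomogeneous m → (f φ).IsHomogeneous (m + k)) {d : ℕ} (hd : d < k)
    (φ : MvPolynomial σ R) : homogeneousComponent d (f φ) = 0 := by
  rw [← sum_homogeneousComponent φ, map_sum, map_sum]
  refine Finset.sum_eq_zero fun i _ => ?_
  rw [homogeneousComponent_of_mem (hf i _ (homogeneousComponent_isHomogeneous i φ)), if_neg]
  omega

/-- Coordinates of a pair of matrices: `(false, i, j)` for the first, `(true, i, j)` for the
second. -/
abbrev PairIndex (n : ℕ) : Type := Bool × Fin n × Fin n

variable {n : ℕ}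

/-- The generic matrix in the variables of the first or second member of a pair. -/
noncomputable def genericPair (n : ℕ) (b : Bool) :
    Matrix (Fin n) (Fin n) (MvPolynomial (PairIndex n) ℝ) :=
  Matrix.of fun i j => X (b, i, j)

theorem boolMatrix_genericPair (b : Bool) :
    boolMatrix (genericPair n false) (genericPair n true) b = genericPair n b := by
  cases b <;> rfl

/-- Components of the linear vector field generated by row operations. -/
noncomputable def rowField (p q : Fin n) (k : PairIndex n) : MvPolynomial (PairIndex n) ℝ :=
  if k.1 then (if k.2.1 = q then -X (true, p, k.2.2) else 0)
  else (if k.2.1 = p then X (false, q, k.2.2) else 0)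

/-- Components of the linear vector field generated by column operations. -/
noncomputable def colField (p q : Fin n) (k : PairIndex n) : MvPolynomial (PairIndex n) ℝ :=
  if k.1 then (if k.2.2 = p then -X (true, k.2.1, q) else 0)
  else (if k.2.2 = q then X (false, k.2.1, p) else 0)

theorem rowField_isHomogeneous (p q : Fin n) (k : PairIndex n) :
    (rowField p q k).IsHomogeneous 1 := by
  unfold rowField
  split_ifs
  exacts [(isHomogeneous_X _ _).neg, isHomogeneous_zero _ _ _, isHomogeneous_X _ _,
    isHomogeneous_zero _ _ _]

theorem colField_isHomogeneous (p q : Fin n) (k : PairIndex n) :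
    (colField p q k).IsHomogeneous 1 := by
  unfold colField
  split_ifs
  exacts [(isHomogeneous_X _ _).neg, isHomogeneous_zero _ _ _, isHomogeneous_X _ _,
    isHomogeneous_zero _ _ _]

/-- Reflection in the `p`-th row. -/
noncomputable def rowReflection (p : Fin n) :
    MvPolynomial (PairIndex n) ℝ →ₐ[ℝ] MvPolynomial (PairIndex n) ℝ :=
  aeval fun k => if k.2.1 = p then -X k else X k

/-- Reflection in the `p`-th column. -/
noncomputable def colReflection (p : Fin n) :
    MvPolynomial (PairIndex n) ℝ →ₐ[ℝ] MvPolynomial (PairIndex n) ℝ :=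
  aeval fun k => if k.2.2 = p then -X k else X k

/-- Transposition of both matrices. -/
noncomputable def pairTranspose (n : ℕ) :
    MvPolynomial (PairIndex n) ℝ →ₐ[ℝ] MvPolynomial (PairIndex n) ℝ :=
  rename fun k => (k.1, k.2.2, k.2.1)

/-- The moment map for row operations. -/
noncomputable def rowMoment (n : ℕ) : Matrix (Fin n) (Fin n) (MvPolynomial (PairIndex n) ℝ) :=
  genericPair n false * (genericPair n false)ᵀ - genericPair n true * (genericPair n true)ᵀ

/-- The moment map for column operations. -/
noncomputable def colMoment (n : ℕ) : Matrix (Fin n) (Fin n) (MvPolynomial (PairIndex n) ℝ) :=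
  (genericPair n false)ᵀ * genericPair n false - (genericPair n true)ᵀ * genericPair n true

theorem rowMoment_comm (p q : Fin n) : rowMoment n p q = rowMoment n q p := by
  simp [rowMoment, Matrix.mul_apply, mul_comm]

theorem colMoment_comm (p q : Fin n) : colMoment n p q = colMoment n q p := by
  simp [colMoment, Matrix.mul_apply, mul_comm]

theorem rowMoment_isHomogeneous (p q : Fin n) : (rowMoment n p q).IsHomogeneous 2 := by
  rw [rowMoment, Matrix.sub_apply, Matrix.mul_apply, Matrix.mul_apply]
  exact (IsHomogeneous.sum _ _ _ fun k _ => (isHomogeneous_X _ _).mul (isHomogeneous_X _ _)).sub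
    (IsHomogeneous.sum _ _ _ fun k _ => (isHomogeneous_X _ _).mul (isHomogeneous_X _ _))

theorem colMoment_isHomogeneous (p q : Fin n) : (colMoment n p q).IsHomogeneous 2 := by
  rw [colMoment, Matrix.sub_apply, Matrix.mul_apply, Matrix.mul_apply]
  exact (IsHomogeneous.sum _ _ _ fun k _ => (isHomogeneous_X _ _).mul (isHomogeneous_X _ _)).sub
    (IsHomogeneous.sum _ _ _ fun k _ => (isHomogeneous_X _ _).mul (isHomogeneous_X _ _))

theorem adjoin_genericPair : Algebra.adjoin ℝ {x | ∃ b i j,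
    x = boolMatrix (genericPair n false) (genericPair n true) b i j} = ⊤ := by
  rw [← MvPolynomial.adjoin_range_X]
  congr 1
  ext x
  constructor
  · rintro ⟨b, i, j, rfl⟩
    exact ⟨(b, i, j), by rw [boolMatrix_genericPair]; rfl⟩
  · rintro ⟨⟨b, i, j⟩, rfl⟩
    exact ⟨b, i, j, by rw [boolMatrix_genericPair]; rfl⟩

theorem genericPair_map_row (p q : Fin n) (b : Bool) :
    (genericPair n b).map (mkDerivation ℝ (rowField p q) - mkDerivation ℝ (rowField q p) :
      Derivation ℝ (MvPolynomial (PairIndex n) ℝ) (MvPolynomial (PairIndex n) ℝ)) =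
    (planeRotation _ p q)ᵀ * genericPair n b := by
  ext1 i j
  rw [planeRotation_transpose, neg_mul, Matrix.neg_apply, planeRotation_mul_apply]
  simp only [Matrix.map_apply, genericPair, Matrix.of_apply, Derivation.sub_apply, mkDerivation_X]
  cases b <;> simp [rowField]
  split_ifs <;> ring

theorem genericPair_map_col (p q : Fin n) (b : Bool) :
    (genericPair n b).map (mkDerivation ℝ (colField q p) - mkDerivation ℝ (colField p q) :
      Derivation ℝ (MvPolynomial (PairIndex n) ℝ) (MvPolynomial (PairIndex n) ℝ)) =
    genericPair n b * planeRotation _ p q := by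
  ext1 i j
  rw [mul_planeRotation_apply]
  simp only [Matrix.map_apply, genericPair, Matrix.of_apply, Derivation.sub_apply, mkDerivation_X]
  cases b <;> simp [colField]
  split_ifs <;> ring

theorem genericPair_map_rowReflection (p : Fin n) (b : Bool) :
    (genericPair n b).map (rowReflection p) = coordReflection _ p * genericPair n b := by
  ext1 i j
  rw [coordReflection, Matrix.diagonal_mul]
  simp [genericPair, rowReflection]

theorem genericPair_map_colReflection (p : Fin n) (b : Bool) :
    (genericPair n b).map (colReflection p) = genericPair n b * coordReflection _ p := by
  ext1 i j
  rw [coordReflection, Matrix.mul_diagonal]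
  simp [genericPair, colReflection]

theorem genericPair_map_transpose (b : Bool) :
    (genericPair n b).map (pairTranspose n) = (genericPair n b)ᵀ := by
  ext1 i j
  simp [genericPair, pairTranspose]

theorem homogeneousComponent_map_mkDerivation {f : PairIndex n → MvPolynomial (PairIndex n) ℝ}
    (hf : ∀ k, (f k).IsHomogeneous 1) (d : ℕ) (x : MvPolynomial (PairIndex n) ℝ) :
    homogeneousComponent d (mkDerivation ℝ f x) = mkDerivation ℝ f (homogeneousComponent d x) :=
  homogeneousComponent_comm (mkDerivation ℝ f).toLinearMap 0
    (fun _ _ hφ => hφ.mkDerivation hf) d x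

theorem homogeneousComponent_map_algHom {f : PairIndex n → MvPolynomial (PairIndex n) ℝ}
    (hf : ∀ k, (f k).IsHomogeneous 1) (d : ℕ) (x : MvPolynomial (PairIndex n) ℝ) :
    homogeneousComponent d (aeval f x) = aeval f (homogeneousComponent d x) :=
  homogeneousComponent_comm (aeval f : _ →ₐ[ℝ] _).toLinearMap 0
    (fun m φ hφ => by simpa using hφ.aeval f hf) d x

/-- A linear functional on polynomials on pairs of matrices vanishes if it is odd under
transposition, invariant under reflections, and if row and column operations act on it through
the moment maps. -/
theorem polynomial_functional_eq_zero {Λ : MvPolynomial (PairIndex n) ℝ →ₗ[ℝ] ℝ} {c : ℝ}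
    (hc : c ≠ 0)
    (hrow : ∀ p q f, Λ (mkDerivation ℝ (rowField p q) f) = c * Λ (rowMoment n p q * f))
    (hcol : ∀ p q f, Λ (mkDerivation ℝ (colField p q) f) = c * Λ (colMoment n p q * f))
    (hrl : ∀ p f, Λ (rowReflection p f) = Λ f) (hrr : ∀ p f, Λ (colReflection p f) = Λ f)
    (hτ : ∀ f, Λ (pairTranspose n f) = -Λ f) : Λ = 0 := by
  suffices h : ∀ d, Λ ∘ₗ homogeneousComponent d = 0 by
    refine LinearMap.ext fun f => ?_
    rw [← sum_homogeneousComponent f, map_sum]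
    exact Finset.sum_eq_zero fun d _ => LinearMap.congr_fun (h d) _
  intro d
  induction d using Nat.strong_induction_on with
  | _ d ih =>
  have hlow : ∀ {e f}, e < d → IsHomogeneous f e → Λ f = 0 := fun {e f} he hf => by
    rw [← homogeneousComponent_eq_self hf]
    exact LinearMap.congr_fun (ih e he) f
  let Λd := Λ ∘ₗ homogeneousComponent d
  have hmoment : ∀ (fld : PairIndex n → MvPolynomial (PairIndex n) ℝ) (μ : MvPolynomial _ ℝ),
      (∀ k, (fld k).IsHomogeneous 1) → μ.IsHomogeneous 2 →
      (∀ f, Λ (mkDerivation ℝ fld f) = c * Λ (μ * f)) → ∀ f, Λd (μ * f) = 0 := by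
    intro fld μ hfld hμ h f
    have hμ' : ∀ m φ, IsHomogeneous φ m → (LinearMap.mulLeft ℝ μ φ).IsHomogeneous (m + 2) :=
      fun m φ hφ => by rw [add_comm]; exact hμ.mul hφ
    by_cases hd : d < 2
    · have := homogeneousComponent_of_lt (LinearMap.mulLeft ℝ μ) 2 hμ' hd f
      rw [LinearMap.mulLeft_apply] at this
      simp [Λd, this]
    · obtain ⟨e, rfl⟩ : ∃ e, d = e + 2 := ⟨d - 2, by omega⟩
      have := homogeneousComponent_comm (LinearMap.mulLeft ℝ μ) 2 hμ' e f
      rw [LinearMap.mulLeft_apply, LinearMap.mulLeft_apply] at this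
      have h' := h (homogeneousComponent e f)
      rw [hlow (e := e) (by omega)
        ((homogeneousComponent_isHomogeneous e f).mkDerivation hfld)] at h'
      simpa [Λd, this, hc] using h'.symm
  let I : Ideal (MvPolynomial (PairIndex n) ℝ) :=
    { carrier := {x | ∀ f, Λd (x * f) = 0}
      add_mem' := fun hx hy f => by rw [add_mul, map_add, hx, hy, add_zero]
      zero_mem' := fun f => by simp
      smul_mem' := fun a x hx f => by
        rw [smul_eq_mul, mul_comm a, mul_assoc]; exact hx _ }
  have hrot : ∀ fld fld' : PairIndex n → MvPolynomial (PairIndex n) ℝ,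
      (∀ k, (fld k).IsHomogeneous 1) → (∀ k, (fld' k).IsHomogeneous 1) →
      (∀ f, Λ (mkDerivation ℝ fld f) = Λ (mkDerivation ℝ fld' f)) →
      ∀ f, Λd ((mkDerivation ℝ fld - mkDerivation ℝ fld' : Derivation ℝ _ _) f) = 0 := by
    intro fld fld' h h' heq f
    rw [Derivation.sub_apply, LinearMap.comp_apply, map_sub, map_sub,
      homogeneousComponent_map_mkDerivation h, homogeneousComponent_map_mkDerivation h', heq,
      sub_self]
  have hsign : ∀ (P : PairIndex n → Prop) [DecidablePred P] k,
      (if P k then -X k else X k : MvPolynomial (PairIndex n) ℝ).IsHomogeneous 1 := by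
    intro P _ k
    split_ifs
    exacts [(isHomogeneous_X _ _).neg, isHomogeneous_X _ _]
  refine functional_eq_zero_of_odd (A := genericPair n false) (B := genericPair n true)
    (I := I) (τ := pairTranspose n) (Λ := Λd)
    (Dl := fun p q => mkDerivation ℝ (rowField p q) - mkDerivation ℝ (rowField q p))
    (Dr := fun p q => mkDerivation ℝ (colField q p) - mkDerivation ℝ (colField p q))
    (rl := rowReflection) (rr := colReflection) adjoin_genericPair
    (fun x hx => by simpa using hx 1) ?_
    (fun p q => hmoment _ _ (rowField_isHomogeneous p q) (rowMoment_isHomogeneous p q) (hrow p q))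
    (fun p q => hmoment _ _ (colField_isHomogeneous p q) (colMoment_isHomogeneous p q) (hcol p q))
    (genericPair_map_transpose _) (genericPair_map_transpose _) ?_ ?_ ?_ ?_ ?_ ?_ ?_ ?_
  · intro x
    rw [LinearMap.comp_apply, pairTranspose, ← rename_homogeneousComponent]
    exact hτ _
  · intro p q b; rw [boolMatrix_genericPair, genericPair_map_col]
  · intro p b; rw [boolMatrix_genericPair, genericPair_map_colReflection]
  · intro p q b; rw [boolMatrix_genericPair, genericPair_map_row]
  · intro p b; rw [boolMatrix_genericPair, genericPair_map_rowReflection]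
  · intro p q x
    exact hrot _ _ (colField_isHomogeneous q p) (colField_isHomogeneous p q)
      (fun f => by rw [hcol, hcol, colMoment_comm]) x
  · intro p x
    rw [LinearMap.comp_apply, colReflection,
      homogeneousComponent_map_algHom (hsign fun k => k.2.2 = p)]
    exact hrr p _
  · intro p q x
    exact hrot _ _ (rowField_isHomogeneous p q) (rowField_isHomogeneous q p)
      (fun f => by rw [hrow, hrow, rowMoment_comm]) x
  · intro p x
    rw [LinearMap.comp_apply, rowReflection,
      homogeneousComponent_map_algHom (hsign fun k => k.2.1 = p)]
    exact hrl p _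

end PairPolynomials

section LieDerivative

open SchwartzMap Filter Topology

namespace SchwartzMap

variable {V F : Type} [NormedAddCommGroup V] [NormedSpace ℝ V] [NormedAddCommGroup F]
  [NormedSpace ℝ F]

/-- The derivative of a Schwartz function along the linear vector field `x ↦ A x`. -/
noncomputable def alongField (A : V →L[ℝ] V) (ψ : 𝓢(V, F)) : 𝓢(V, F) :=
  bilinLeftCLM (ContinuousLinearMap.id ℝ (V →L[ℝ] F)) A.hasTemperateGrowth (fderivCLM ℝ V F ψ)

lemma alongField_apply (A : V →L[ℝ] V) (ψ : 𝓢(V, F)) (x : V) :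
    alongField A ψ x = fderiv ℝ ψ x (A x) := rfl

/-- Postcomposition of a Schwartz family of linear maps with `B` on the source side. -/
noncomputable def precompField (B : V →L[ℝ] V) (L : 𝓢(V, V →L[ℝ] F)) : 𝓢(V, V →L[ℝ] F) :=
  L.postcompCLM ((ContinuousLinearMap.compL ℝ V V F).flip B)

lemma precompField_apply (B : V →L[ℝ] V) (L : 𝓢(V, V →L[ℝ] F)) (x : V) :
    precompField B L x = (L x).comp B := rfl

lemma seminorm_precompField_le (B : V →L[ℝ] V) (L : 𝓢(V, V →L[ℝ] F)) (k l : ℕ) :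
    SchwartzMap.seminorm ℝ k l (precompField B L) ≤ ‖B‖ * SchwartzMap.seminorm ℝ k l L := by
  refine SchwartzMap.seminorm_le_bound ℝ k l _ (by positivity) fun x => ?_
  have h1 : (precompField B L : V → V →L[ℝ] F) =
    ((ContinuousLinearMap.compL ℝ V V F).flip B) ∘ L := rfl
  have h2 : ‖iteratedFDeriv ℝ l (precompField B L) x‖ ≤ ‖B‖ * ‖iteratedFDeriv ℝ l L x‖ := by
    rw [h1]
    refine (ContinuousLinearMap.norm_iteratedFDeriv_comp_left _
      (L.smooth ⊤).contDiffAt (by exact_mod_cast le_top)).trans ?_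
    gcongr
    refine ContinuousLinearMap.opNorm_le_bound _ (norm_nonneg _) fun M => ?_
    simpa [mul_comm] using ContinuousLinearMap.opNorm_comp_le M B
  calc ‖x‖ ^ k * ‖iteratedFDeriv ℝ l (precompField B L) x‖
      ≤ ‖x‖ ^ k * (‖B‖ * ‖iteratedFDeriv ℝ l L x‖) := by gcongr
    _ = ‖B‖ * (‖x‖ ^ k * ‖iteratedFDeriv ℝ l L x‖) := by ring
    _ ≤ _ := by gcongr; exact L.le_seminorm ℝ k l x

/-- The error of the difference quotient with step `s⁻¹` along the linear change of variables `g`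
compared with the derivative along `A`. -/
noncomputable def quotientError (s : ℝ) (g : V ≃L[ℝ] V) (A : V →L[ℝ] V) (ψ : 𝓢(V, F)) :
    𝓢(V, F) :=
  s • (compCLMOfContinuousLinearEquiv ℝ g ψ - ψ) - alongField A ψ

lemma quotientError_apply (s : ℝ) (g : V ≃L[ℝ] V) (A : V →L[ℝ] V) (ψ : 𝓢(V, F)) (x : V) :
    quotientError s g A ψ x = s • (ψ (g x) - ψ x) - fderiv ℝ ψ x (A x) := rfl

lemma fderivCLM_quotientError (s : ℝ) (g : V ≃L[ℝ] V) (A : V →L[ℝ] V) (ψ : 𝓢(V, F)) :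
    fderivCLM ℝ V F (quotientError s g A ψ) =
      precompField (g : V →L[ℝ] V) (quotientError s g A (fderivCLM ℝ V F ψ)) +
      precompField ((g : V →L[ℝ] V) - 1) (alongField A (fderivCLM ℝ V F ψ)) +
      precompField (s • ((g : V →L[ℝ] V) - 1) - A) (fderivCLM ℝ V F ψ) := by
  ext x v
  have hψ : ∀ y, HasFDerivAt ψ (fderiv ℝ ψ y) y := fun y => ψ.differentiableAt.hasFDerivAt
  have hD : ∀ y, HasFDerivAt (fderiv ℝ ψ) (fderiv ℝ (fderiv ℝ ψ) y) y := fun y =>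
    (fderivCLM ℝ V F ψ).differentiableAt.hasFDerivAt
  have hs : fderiv ℝ (fderiv ℝ ψ) x v (A x) = fderiv ℝ (fderiv ℝ ψ) x (A x) v :=
    ((ψ.smooth ⊤).contDiffAt.isSymmSndFDerivAt (by simpa using WithTop.coe_le_coe.mpr (le_top : (2 : ℕ∞) ≤ ⊤))).eq v (A x)
  have h1 : HasFDerivAt (quotientError s g A ψ)
      (s • ((fderiv ℝ ψ (g x)).comp (g : V →L[ℝ] V) - fderiv ℝ ψ x) -
        ((fderiv ℝ ψ x).comp A + (fderiv ℝ (fderiv ℝ ψ) x).flip (A x))) x := by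
    refine (((hψ (g x)).comp x g.hasFDerivAt).sub (hψ x)).const_smul s |>.sub ?_
    exact (hD x).clm_apply A.hasFDerivAt
  rw [fderivCLM_apply, h1.fderiv]
  simp only [add_apply, precompField_apply, quotientError_apply, alongField_apply, fderivCLM_apply]
  have e : (⇑(fderivCLM ℝ V F ψ) : V → V →L[ℝ] F) = fderiv ℝ ψ := rfl
  simp only [e]
  simp [hs, smul_sub]
  abel

lemma norm_le_two_mul_of_mem_segment {x y : V} (hy : ‖y - x‖ ≤ ‖x‖ / 2) {z : V}
    (hz : z ∈ segment ℝ x y) : ‖x‖ ≤ 2 * ‖z‖ := by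
  have h := norm_sub_le_of_mem_segment hz
  have h2 : ‖x‖ ≤ ‖z‖ + ‖z - x‖ := by
    have := norm_sub_norm_le x z
    rw [norm_sub_rev] at this; linarith
  linarith

/-- Second order Taylor estimate with the decay of the second derivative. -/
lemma pow_mul_norm_taylor_le (ψ : 𝓢(V, F)) (k : ℕ) {x y : V} {ε : ℝ} (hε : ε ≤ 1 / 2)
    (hy : ‖y - x‖ ≤ ε * ‖x‖) :
    ‖x‖ ^ k * ‖ψ y - ψ x - fderiv ℝ ψ x (y - x)‖ ≤
      2 ^ (k + 2) * SchwartzMap.seminorm ℝ (k + 2) 0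
        (fderivCLM ℝ V _ (fderivCLM ℝ V F ψ)) * ε ^ 2 := by
  set P := SchwartzMap.seminorm ℝ (k + 2) 0 (fderivCLM ℝ V _ (fderivCLM ℝ V F ψ)) with hP
  have hP0 : 0 ≤ P := apply_nonneg _ _
  rcases eq_or_ne x 0 with rfl | hx
  · have : y = 0 := by simpa using hy
    subst this
    simp; positivity
  have hx0 : 0 < ‖x‖ := norm_pos_iff.mpr hx
  have hy2 : ‖y - x‖ ≤ ‖x‖ / 2 := hy.trans (by nlinarith)
  set K := 2 ^ (k + 2) * P / ‖x‖ ^ (k + 2) with hK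
  have hK0 : 0 ≤ K := by positivity
  have hsec : ∀ z ∈ segment ℝ x y, ‖fderiv ℝ (fderiv ℝ ψ) z‖ ≤ K := by
    intro z hz
    have h1 := norm_le_two_mul_of_mem_segment hy2 hz
    rw [hK, le_div_iff₀ (by positivity)]
    have h2 : ‖z‖ ^ (k + 2) * ‖fderiv ℝ (fderiv ℝ ψ) z‖ ≤ P :=
      norm_pow_mul_le_seminorm ℝ (fderivCLM ℝ V _ (fderivCLM ℝ V F ψ)) (k + 2) z
    calc ‖fderiv ℝ (fderiv ℝ ψ) z‖ * ‖x‖ ^ (k + 2)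
        ≤ ‖fderiv ℝ (fderiv ℝ ψ) z‖ * (2 * ‖z‖) ^ (k + 2) := by gcongr
      _ = 2 ^ (k + 2) * (‖z‖ ^ (k + 2) * ‖fderiv ℝ (fderiv ℝ ψ) z‖) := by rw [mul_pow]; ring
      _ ≤ _ := by gcongr
  have hfirst : ∀ z ∈ segment ℝ x y, ‖fderiv ℝ ψ z - fderiv ℝ ψ x‖ ≤ K * (ε * ‖x‖) := by
    intro z hz
    have h := (convex_segment x y).norm_image_sub_le_of_norm_hasFDerivWithin_le
      (f := fderiv ℝ ψ) (C := K)
      (fun w _ => ((fderivCLM ℝ V F ψ).differentiableAt (x := w)).hasFDerivAt.hasFDerivWithinAt)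
      hsec (left_mem_segment ℝ x y) hz
    refine h.trans ?_
    gcongr
    exact (norm_sub_le_of_mem_segment hz).trans hy
  have h := (convex_segment x y).norm_image_sub_le_of_norm_hasFDerivWithin_le'
      (f := ψ) (φ := fderiv ℝ ψ x) (C := K * (ε * ‖x‖))
      (fun w _ => (ψ.differentiableAt (x := w)).hasFDerivAt.hasFDerivWithinAt)
      hfirst (left_mem_segment ℝ x y) (right_mem_segment ℝ x y)
  have hε0 : 0 ≤ ε := by
    by_contra hc
    have := norm_nonneg (y - x)
    nlinarith
  calc ‖x‖ ^ k * ‖ψ y - ψ x - fderiv ℝ ψ x (y - x)‖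
      ≤ ‖x‖ ^ k * (K * (ε * ‖x‖) * (ε * ‖x‖)) := by gcongr; exact h.trans (by gcongr)
    _ = 2 ^ (k + 2) * P * ε ^ 2 := by
      rw [hK, pow_add ‖x‖ k 2]; field_simp

lemma seminorm_zero_quotientError_le (s : ℝ) (g : V ≃L[ℝ] V) (A : V →L[ℝ] V) (ψ : 𝓢(V, F))
    (k : ℕ) (hg : ‖(g : V →L[ℝ] V) - 1‖ ≤ 1 / 2) :
    SchwartzMap.seminorm ℝ k 0 (quotientError s g A ψ) ≤
      2 ^ (k + 2) * SchwartzMap.seminorm ℝ (k + 2) 0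
          (fderivCLM ℝ V _ (fderivCLM ℝ V F ψ)) *
        (‖s • ((g : V →L[ℝ] V) - 1)‖ * ‖(g : V →L[ℝ] V) - 1‖) +
      SchwartzMap.seminorm ℝ (k + 1) 0 (fderivCLM ℝ V F ψ) *
        ‖s • ((g : V →L[ℝ] V) - 1) - A‖ := by
  refine SchwartzMap.seminorm_le_bound ℝ k 0 _ (by positivity) fun x => ?_
  rw [norm_iteratedFDeriv_zero, quotientError_apply]
  have e : s • (ψ (g x) - ψ x) - fderiv ℝ ψ x (A x) =
      s • (ψ (g x) - ψ x - fderiv ℝ ψ x (g x - x)) +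
        fderiv ℝ ψ x ((s • ((g : V →L[ℝ] V) - 1) - A) x) := by
    simp [smul_sub]
  have h1 := pow_mul_norm_taylor_le ψ k hg (x := x) (y := g x)
    (by simpa using ((g : V →L[ℝ] V) - 1).le_opNorm x)
  have h2 : ‖x‖ ^ (k + 1) * ‖fderiv ℝ ψ x‖ ≤ _ :=
    norm_pow_mul_le_seminorm ℝ (fderivCLM ℝ V F ψ) (k + 1) x
  set B := s • ((g : V →L[ℝ] V) - 1) - A
  rw [e]
  calc ‖x‖ ^ k * ‖s • (ψ (g x) - ψ x - fderiv ℝ ψ x (g x - x)) + fderiv ℝ ψ x (B x)‖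
      ≤ ‖x‖ ^ k * (|s| * ‖ψ (g x) - ψ x - fderiv ℝ ψ x (g x - x)‖ +
          ‖fderiv ℝ ψ x‖ * (‖B‖ * ‖x‖)) := by
        gcongr
        refine (norm_add_le _ _).trans ?_
        rw [norm_smul, Real.norm_eq_abs]
        gcongr
        exact ((fderiv ℝ ψ x).le_opNorm _).trans (by gcongr; exact B.le_opNorm x)
    _ = |s| * (‖x‖ ^ k * ‖ψ (g x) - ψ x - fderiv ℝ ψ x (g x - x)‖) +
          ‖x‖ ^ (k + 1) * ‖fderiv ℝ ψ x‖ * ‖B‖ := by ring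
    _ ≤ |s| * (2 ^ (k + 2) * SchwartzMap.seminorm ℝ (k + 2) 0
            (fderivCLM ℝ V _ (fderivCLM ℝ V F ψ)) * ‖(g : V →L[ℝ] V) - 1‖ ^ 2) +
          SchwartzMap.seminorm ℝ (k + 1) 0 (fderivCLM ℝ V F ψ) * ‖B‖ := by gcongr
    _ = _ := by rw [norm_smul, Real.norm_eq_abs]; ring

theorem tendsto_seminorm_quotientError {ι : Type} {l : Filter ι} {s : ι → ℝ} {g : ι → V ≃L[ℝ] V}
    {A : V →L[ℝ] V} (hg : Tendsto (fun i => (g i : V →L[ℝ] V)) l (𝓝 1))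
    (hA : Tendsto (fun i => s i • ((g i : V →L[ℝ] V) - 1)) l (𝓝 A)) (k m : ℕ)
    (ψ : 𝓢(V, F)) :
    Tendsto (fun i => SchwartzMap.seminorm ℝ k m (quotientError (s i) (g i) A ψ)) l (𝓝 0) := by
  have hg' : Tendsto (fun i => ‖(g i : V →L[ℝ] V) - 1‖) l (𝓝 0) :=
    tendsto_iff_norm_sub_tendsto_zero.mp hg
  have hA' : Tendsto (fun i => ‖s i • ((g i : V →L[ℝ] V) - 1) - A‖) l (𝓝 0) :=
    tendsto_iff_norm_sub_tendsto_zero.mp hA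
  induction m generalizing F with
  | zero =>
    refine squeeze_zero' (.of_forall fun i => apply_nonneg _ _)
      ((hg'.eventually (ge_mem_nhds (by norm_num : (0 : ℝ) < 1 / 2))).mono fun i hi =>
        seminorm_zero_quotientError_le (s i) (g i) A ψ k hi) ?_
    have := ((hA.norm.mul hg').const_mul (2 ^ (k + 2) * SchwartzMap.seminorm ℝ (k + 2) 0
          (fderivCLM ℝ V _ (fderivCLM ℝ V F ψ)))).add
        (hA'.const_mul (SchwartzMap.seminorm ℝ (k + 1) 0 (fderivCLM ℝ V F ψ)))
    simpa using this
  | succ m ih =>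
    have hle : ∀ i, SchwartzMap.seminorm ℝ k (m + 1) (quotientError (s i) (g i) A ψ) ≤
        ‖(g i : V →L[ℝ] V)‖ *
          SchwartzMap.seminorm ℝ k m (quotientError (s i) (g i) A (fderivCLM ℝ V F ψ)) +
        ‖(g i : V →L[ℝ] V) - 1‖ *
          SchwartzMap.seminorm ℝ k m (alongField A (fderivCLM ℝ V F ψ)) +
        ‖s i • ((g i : V →L[ℝ] V) - 1) - A‖ *
          SchwartzMap.seminorm ℝ k m (fderivCLM ℝ V F ψ) := by
      intro i
      have h1 : SchwartzMap.seminorm ℝ k (m + 1) (quotientError (s i) (g i) A ψ) ≤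
          SchwartzMap.seminorm ℝ k m (fderivCLM ℝ V F (quotientError (s i) (g i) A ψ)) := by
        refine SchwartzMap.seminorm_le_bound ℝ _ _ _ (apply_nonneg _ _) fun x => ?_
        rw [← norm_iteratedFDeriv_fderiv]
        exact (fderivCLM ℝ V F (quotientError (s i) (g i) A ψ)).le_seminorm ℝ k m x
      refine h1.trans ?_
      rw [fderivCLM_quotientError]
      refine (map_add_le_add _ _ _).trans (add_le_add ((map_add_le_add _ _ _).trans
        (add_le_add ?_ ?_)) ?_) <;> exact seminorm_precompField_le _ _ _ _
    refine squeeze_zero (fun i => apply_nonneg _ _) hle ?_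
    have := ((hg.norm.mul (ih (fderivCLM ℝ V F ψ))).add
      (hg'.mul_const (SchwartzMap.seminorm ℝ k m (alongField A (fderivCLM ℝ V F ψ))))).add
      (hA'.mul_const (SchwartzMap.seminorm ℝ k m (fderivCLM ℝ V F ψ)))
    simpa using this

/-- A tempered distribution invariant under a differentiable family of linear changes of variables
kills the derivatives along the generating linear vector field. -/
theorem map_alongField_eq_zero (U : 𝓢(V, ℂ) →L[ℂ] ℂ) {g : ℝ → V ≃L[ℝ] V} {A : V →L[ℝ] V}
    (h0 : (g 0 : V →L[ℝ] V) = 1) (hA : HasDerivAt (fun t => (g t : V →L[ℝ] V)) A 0)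
    (hU : ∀ t ψ, U (compCLMOfContinuousLinearEquiv ℝ (g t) ψ) = U ψ) (ψ : 𝓢(V, ℂ)) :
    U (alongField A ψ) = 0 := by
  have hg : Tendsto (fun t => (g t : V →L[ℝ] V)) (𝓝[≠] 0) (𝓝 1) := by
    have := hA.continuousAt.tendsto
    rw [h0] at this
    exact this.mono_left nhdsWithin_le_nhds
  have hs : Tendsto (fun t : ℝ => t⁻¹ • ((g t : V →L[ℝ] V) - 1)) (𝓝[≠] 0) (𝓝 A) := by
    have := hA.tendsto_slope_zero
    simpa [h0] using this
  have hR : Tendsto (fun t : ℝ => quotientError t⁻¹ (g t) A ψ) (𝓝[≠] 0) (𝓝 0) := by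
    rw [(schwartz_withSeminorms ℝ V ℂ).tendsto_nhds]
    intro i ε hε
    have := tendsto_seminorm_quotientError hg hs i.1 i.2 ψ
    simpa [schwartzSeminormFamily] using this.eventually (gt_mem_nhds hε)
  have hlim := (U.continuous.tendsto 0).comp hR
  have hconst : ∀ t : ℝ, U (quotientError t⁻¹ (g t) A ψ) = -U (alongField A ψ) := by
    intro t
    have : quotientError t⁻¹ (g t) A ψ =
      ((t⁻¹ : ℝ) : ℂ) • (compCLMOfContinuousLinearEquiv ℝ (g t) ψ - ψ) - alongField A ψ := by
      ext x; simp [quotientError_apply, alongField_apply]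
    rw [this, map_sub, map_smul, map_sub, hU, sub_self, smul_zero, zero_sub]
  have h2 : Tendsto (fun _ : ℝ => -U (alongField A ψ)) (𝓝[≠] 0) (𝓝 0) := by
    refine (hlim.congr fun t => hconst t).trans ?_
    simp
  simpa using tendsto_nhds_unique tendsto_const_nhds h2

end SchwartzMap
end LieDerivative

section Gaussian

open SchwartzMap Filter Topology

variable {V : Type} [NormedAddCommGroup V] [InnerProductSpace ℝ V]

lemma one_add_pow_mul_exp_neg_sq_le {a r : ℝ} (ha : 0 < a) (hr : 0 ≤ r) (N : ℕ) :
    (1 + r) ^ N * Real.exp (-a * r ^ 2) ≤ N.factorial * Real.exp (1 + 1 / (4 * a)) := by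
  have h1 : (1 + r) ^ N ≤ N.factorial * Real.exp (1 + r) := by
    have := Real.pow_div_factorial_le_exp (1 + r) (by positivity) N
    rwa [div_le_iff₀' (by positivity)] at this
  calc (1 + r) ^ N * Real.exp (-a * r ^ 2)
      ≤ N.factorial * Real.exp (1 + r) * Real.exp (-a * r ^ 2) := by gcongr
    _ = N.factorial * Real.exp (1 + r + -a * r ^ 2) := by rw [Real.exp_add (1 + r)]; ring
    _ ≤ _ := by
      refine mul_le_mul_of_nonneg_left (Real.exp_le_exp.mpr ?_) (by positivity)
      have h2 : 0 ≤ a * (r - 1 / (2 * a)) ^ 2 := by positivity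
      have h3 : a * (r - 1 / (2 * a)) ^ 2 = a * r ^ 2 - r + 1 / (4 * a) := by
        field_simp; ring
      linarith

lemma gaussian_decay {a : ℝ} (ha : 0 < a) (k n : ℕ) :
    ∃ C, ∀ x : V, ‖x‖ ^ k * ‖iteratedFDeriv ℝ n (fun x : V => Real.exp (-a * ‖x‖ ^ 2)) x‖ ≤ C := by
  have htg : (fun x : V => -a * ‖x‖ ^ 2).HasTemperateGrowth := by
    have := Function.hasTemperateGrowth_norm_sq V
    fun_prop
  obtain ⟨m, C, hC, hb⟩ := htg.norm_iteratedFDeriv_le_uniform n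
  refine ⟨n.factorial * (C + 1) ^ n *
    ((k + m * n).factorial * Real.exp (1 + 1 / (4 * a))), fun x => ?_⟩
  have h1 := norm_iteratedFDeriv_comp_le (n := n) (N := ((⊤ : ℕ∞) : WithTop ℕ∞))
    (g := Real.exp) Real.contDiff_exp htg.1 (by exact_mod_cast le_top) x
    (C := Real.exp (-a * ‖x‖ ^ 2)) (D := (C + 1) * (1 + ‖x‖) ^ m)
    (fun i _ => by
      rw [norm_iteratedFDeriv_eq_norm_iteratedDeriv, iteratedDeriv_eq_iterate, Real.iter_deriv_exp]
      simp)
    (fun i hi hin => by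
      have hone : 1 ≤ (1 + ‖x‖) ^ m := one_le_pow₀ (by simp)
      have h2 : C * (1 + ‖x‖) ^ m ≤ (C + 1) * (1 + ‖x‖) ^ m := by gcongr; simp
      refine ((hb i hin x).trans h2).trans (le_self_pow₀ ?_ (by omega))
      nlinarith)
  have hx : ‖x‖ ^ k ≤ (1 + ‖x‖) ^ k := by gcongr; simp
  calc ‖x‖ ^ k * ‖iteratedFDeriv ℝ n (fun x : V => Real.exp (-a * ‖x‖ ^ 2)) x‖
      ≤ (1 + ‖x‖) ^ k * (n.factorial * Real.exp (-a * ‖x‖ ^ 2) * ((C + 1) * (1 + ‖x‖) ^ m) ^ n) := by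
        gcongr; exact h1
    _ = n.factorial * (C + 1) ^ n * ((1 + ‖x‖) ^ (k + m * n) * Real.exp (-a * ‖x‖ ^ 2)) := by
        rw [mul_pow, pow_add, pow_mul]; ring
    _ ≤ _ := by
        exact mul_le_mul_of_nonneg_left
          (one_add_pow_mul_exp_neg_sq_le ha (norm_nonneg x) _) (by positivity)

/-- The Gaussian `x ↦ exp (-a ‖x‖²)` as a Schwartz function. -/
noncomputable def gaussianSchwartz (a : ℝ) (ha : 0 < a) : 𝓢(V, ℂ) :=
  SchwartzMap.postcompCLM (𝕜 := ℝ) Complex.ofRealCLM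
    { toFun := fun x => Real.exp (-a * ‖x‖ ^ 2)
      smooth' := by
        have := contDiff_norm_sq ℝ (E := V) (n := ((⊤ : ℕ∞) : WithTop ℕ∞))
        fun_prop
      decay' := gaussian_decay ha }

lemma gaussianSchwartz_apply {a : ℝ} (ha : 0 < a) (x : V) :
    gaussianSchwartz a ha x = Complex.exp (-a * ‖x‖ ^ 2) := by
  have : gaussianSchwartz a ha x = ((Real.exp (-a * ‖x‖ ^ 2) : ℝ) : ℂ) := rfl
  rw [this]; push_cast; rfl

end Gaussian

section CompactSupportDensity

open SchwartzMap Filter Topology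

variable {V : Type} [NormedAddCommGroup V] [InnerProductSpace ℝ V] [FiniteDimensional ℝ V]

/-- The dilated cutoffs `x ↦ χ (x / (N + 1)) - 1` have derivatives bounded by a multiple of
`‖x‖ / (N + 1)`. -/
lemma norm_iteratedFDeriv_dilated_bump_sub_one_le (χ : ContDiffBump (0 : V)) (hχ : χ.rIn = 1)
    (i : ℕ) : ∃ C, 0 ≤ C ∧ ∀ (N : ℕ) (x : V),
      ‖iteratedFDeriv ℝ i (fun x : V => χ ((N + 1 : ℝ)⁻¹ • x) - 1) x‖ ≤
        C * (‖x‖ * (N + 1 : ℝ)⁻¹) := by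
  have hsm : ContDiff ℝ ((⊤ : ℕ∞) : WithTop ℕ∞) χ := χ.contDiff
  set u : V → ℝ := fun x => χ x - 1 with hu
  have husm : ContDiff ℝ ((⊤ : ℕ∞) : WithTop ℕ∞) u := hsm.sub contDiff_const
  have hile : ((i : ℕ∞) : WithTop ℕ∞) ≤ ((⊤ : ℕ∞) : WithTop ℕ∞) := by exact_mod_cast le_top
  obtain ⟨C, hC⟩ : ∃ C, ∀ x, ‖iteratedFDeriv ℝ i u x‖ ≤ C := by
    refine ⟨SchwartzMap.seminorm ℝ 0 i (χ.hasCompactSupport.toSchwartzMap hsm) +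
      ‖iteratedFDeriv ℝ i (fun _ : V => (1 : ℝ)) 0‖, fun x => ?_⟩
    have h1 : iteratedFDeriv ℝ i u x = iteratedFDeriv ℝ i χ x -
        iteratedFDeriv ℝ i (fun _ : V => (1 : ℝ)) x :=
      iteratedFDeriv_sub_apply (hsm.of_le hile).contDiffAt contDiff_const.contDiffAt
    have h2 : ‖iteratedFDeriv ℝ i (fun _ : V => (1 : ℝ)) x‖ ≤
        ‖iteratedFDeriv ℝ i (fun _ : V => (1 : ℝ)) 0‖ := by
      rcases i with _ | i
      · simp
      · simp [iteratedFDeriv_succ_const]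
    rw [h1]
    refine (norm_sub_le _ _).trans (add_le_add ?_ h2)
    exact norm_iteratedFDeriv_le_seminorm ℝ (χ.hasCompactSupport.toSchwartzMap hsm) i x
  have hC0 : 0 ≤ C := (norm_nonneg _).trans (hC 0)
  refine ⟨C, hC0, fun N x => ?_⟩
  have hN : (0 : ℝ) < N + 1 := by positivity
  have hcomp := iteratedFDeriv_comp_const_smul (𝕜 := ℝ) (i := i) ((N + 1 : ℝ)⁻¹) (husm.of_le hile)
  have hval : iteratedFDeriv ℝ i (fun x : V => χ ((N + 1 : ℝ)⁻¹ • x) - 1) x =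
      ((N + 1 : ℝ)⁻¹) ^ i • iteratedFDeriv ℝ i u ((N + 1 : ℝ)⁻¹ • x) := congrFun hcomp x
  rcases lt_or_ge (‖x‖ * (N + 1 : ℝ)⁻¹) 1 with hx | hx
  · have hnorm : ‖(N + 1 : ℝ)⁻¹ • x‖ < 1 := by
      rw [norm_smul, norm_inv, Real.norm_of_nonneg hN.le, mul_comm]; exact hx
    have hev : u =ᶠ[𝓝 ((N + 1 : ℝ)⁻¹ • x)] fun _ => 0 := by
      filter_upwards [Metric.isOpen_ball.mem_nhds (show (N + 1 : ℝ)⁻¹ • x ∈ Metric.ball (0 : V) 1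
        by simpa using hnorm)] with y hy
      rw [hu]
      simp only
      rw [χ.one_of_mem_closedBall (by rw [hχ]; exact Metric.ball_subset_closedBall hy), sub_self]
    rw [hval, (hev.iteratedFDeriv ℝ i).eq_of_nhds]
    have : iteratedFDeriv ℝ i (fun _ : V => (0 : ℝ)) ((N + 1 : ℝ)⁻¹ • x) = 0 := by
      rw [iteratedFDeriv_fun_zero]; rfl
    rw [this, smul_zero, norm_zero]
    positivity
  · rw [hval, norm_smul]
    calc ‖((N + 1 : ℝ)⁻¹) ^ i‖ * ‖iteratedFDeriv ℝ i u ((N + 1 : ℝ)⁻¹ • x)‖ ≤ 1 * C := by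
          gcongr
          · rw [norm_pow]
            refine pow_le_one₀ (norm_nonneg _) ?_
            rw [norm_inv, Real.norm_of_nonneg hN.le]
            exact inv_le_one_of_one_le₀ (by simp)
          · exact hC _
      _ ≤ _ := by nlinarith

theorem exists_tendsto_hasCompactSupport (f : 𝓢(V, ℂ)) :
    ∃ F : ℕ → 𝓢(V, ℂ), (∀ N, HasCompactSupport (F N)) ∧ Tendsto F atTop (𝓝 f) := by
  let χ : ContDiffBump (0 : V) := ⟨1, 2, one_pos, one_lt_two⟩
  have hsm : ContDiff ℝ ((⊤ : ℕ∞) : WithTop ℕ∞) χ := χ.contDiff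
  have hcs : ∀ N : ℕ, HasCompactSupport (fun x : V => χ ((N + 1 : ℝ)⁻¹ • x)) := fun N =>
    χ.hasCompactSupport.comp_smul (by positivity)
  have hsmN : ∀ N : ℕ, ContDiff ℝ ((⊤ : ℕ∞) : WithTop ℕ∞) (fun x : V => χ ((N + 1 : ℝ)⁻¹ • x)) :=
    fun N => hsm.comp (contDiff_const_smul _)
  have htg : ∀ N : ℕ, (fun x : V => χ ((N + 1 : ℝ)⁻¹ • x)).HasTemperateGrowth := fun N =>
    (hcs N).hasTemperateGrowth (hsmN N)
  have happ : ∀ (N : ℕ) (x : V), smulLeftCLM ℂ (fun x : V => χ ((N + 1 : ℝ)⁻¹ • x)) f x =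
      χ ((N + 1 : ℝ)⁻¹ • x) • f x := fun N x => smulLeftCLM_apply_apply (htg N) f x
  refine ⟨fun N => smulLeftCLM ℂ (fun x : V => χ ((N + 1 : ℝ)⁻¹ • x)) f, fun N => ?_, ?_⟩
  · rw [show (⇑(smulLeftCLM ℂ (fun x : V => χ ((N + 1 : ℝ)⁻¹ • x)) f) : V → ℂ) =
      (fun x : V => χ ((N + 1 : ℝ)⁻¹ • x)) • ⇑f from funext fun x => happ N x]
    exact (hcs N).smul_right
  rw [(schwartz_withSeminorms ℝ V ℂ).tendsto_nhds]
  rintro ⟨k, l⟩ ε hε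
  choose C hC0 hC using norm_iteratedFDeriv_dilated_bump_sub_one_le χ rfl
  set K := ∑ i ∈ Finset.range (l + 1), (l.choose i : ℝ) * C i *
    SchwartzMap.seminorm ℝ (k + 1) (l - i) f with hK
  have hbound : ∀ N : ℕ, SchwartzMap.seminorm ℝ k l
      (smulLeftCLM ℂ (fun x : V => χ ((N + 1 : ℝ)⁻¹ • x)) f - f) ≤ K * (N + 1 : ℝ)⁻¹ := by
    intro N
    have hK0 : 0 ≤ K := Finset.sum_nonneg fun i _ =>
      mul_nonneg (mul_nonneg (by positivity) (hC0 i)) (apply_nonneg _ _)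
    refine SchwartzMap.seminorm_le_bound ℝ k l _ (by positivity) fun x => ?_
    have hfun : (⇑(smulLeftCLM ℂ (fun x : V => χ ((N + 1 : ℝ)⁻¹ • x)) f - f) : V → ℂ) =
        fun x => (χ ((N + 1 : ℝ)⁻¹ • x) - 1) • f x := by
      ext y
      rw [_root_.sub_apply, happ, sub_smul, one_smul]
    rw [hfun]
    have hL := norm_iteratedFDeriv_smul_le (𝕜 := ℝ) (N := ((⊤ : ℕ∞) : WithTop ℕ∞)) (n := l)
      ((hsmN N).sub (contDiff_const (c := 1))) (f.smooth ⊤) x (by exact_mod_cast le_top)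
    refine (mul_le_mul_of_nonneg_left hL (by positivity)).trans ?_
    calc ‖x‖ ^ k * ∑ i ∈ Finset.range (l + 1), (l.choose i : ℝ) *
            ‖iteratedFDeriv ℝ i (fun x : V => χ ((N + 1 : ℝ)⁻¹ • x) - 1) x‖ *
            ‖iteratedFDeriv ℝ (l - i) f x‖
        = ∑ i ∈ Finset.range (l + 1), (l.choose i : ℝ) *
            ‖iteratedFDeriv ℝ i (fun x : V => χ ((N + 1 : ℝ)⁻¹ • x) - 1) x‖ *
            (‖x‖ ^ k * ‖iteratedFDeriv ℝ (l - i) f x‖) := by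
          rw [Finset.mul_sum]
          exact Finset.sum_congr rfl fun i _ => by ring
      _ ≤ ∑ i ∈ Finset.range (l + 1), (l.choose i : ℝ) * (C i * (‖x‖ * (N + 1 : ℝ)⁻¹)) *
            (‖x‖ ^ k * ‖iteratedFDeriv ℝ (l - i) f x‖) := by
          gcongr with i _; exact hC i N x
      _ = ∑ i ∈ Finset.range (l + 1), ((l.choose i : ℝ) * C i *
            (‖x‖ ^ (k + 1) * ‖iteratedFDeriv ℝ (l - i) f x‖)) * (N + 1 : ℝ)⁻¹ :=
          Finset.sum_congr rfl fun i _ => by ring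
      _ ≤ _ := by
          rw [hK, Finset.sum_mul]
          gcongr with i _
          · exact mul_nonneg (by positivity) (hC0 i)
          · exact f.le_seminorm ℝ (k + 1) (l - i) x
  have hlim : Tendsto (fun N : ℕ => K * (N + 1 : ℝ)⁻¹) atTop (𝓝 0) := by
    simpa using (tendsto_one_div_add_atTop_nhds_zero_nat (𝕜 := ℝ)).const_mul K
  filter_upwards [hlim.eventually (gt_mem_nhds hε)] with N hN
  exact (hbound N).trans_lt hN

/-- A tempered distribution killing every multiple of a Gaussian is zero. -/
theorem eq_zero_of_gaussian_mul {W : 𝓢(V, ℂ) →L[ℂ] ℂ} {a : ℝ} (ha : 0 < a)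
    (hW : ∀ φ ψ : 𝓢(V, ℂ), (∀ x, ψ x = gaussianSchwartz a ha x * φ x) → W ψ = 0) : W = 0 := by
  have hc : ∀ ψ : 𝓢(V, ℂ), HasCompactSupport ψ → W ψ = 0 := by
    intro ψ hψ
    have hcs : HasCompactSupport (fun x => ψ x * Complex.exp (a * ‖x‖ ^ 2)) := hψ.mul_right
    refine hW (hcs.toSchwartzMap ?_) ψ fun x => ?_
    · have h1 : ContDiff ℝ ((⊤ : ℕ∞) : WithTop ℕ∞)
          (fun x : V => Complex.exp (((a * ‖x‖ ^ 2 : ℝ)) : ℂ)) := by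
        have := contDiff_norm_sq ℝ (E := V) (n := ((⊤ : ℕ∞) : WithTop ℕ∞))
        exact Complex.contDiff_exp.comp (Complex.ofRealCLM.contDiff.comp (contDiff_const.mul this))
      have h2 := (ψ.smooth ⊤).mul h1
      push_cast at h2
      exact h2
    · rw [gaussianSchwartz_apply]
      change ψ x = Complex.exp (-a * ‖x‖ ^ 2) * (ψ x * Complex.exp (a * ‖x‖ ^ 2))
      rw [mul_left_comm, ← Complex.exp_add]
      simp
  ext f
  obtain ⟨F, hF, hlim⟩ := exists_tendsto_hasCompactSupport f
  have h1 := (W.continuous.tendsto f).comp hlim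
  have h2 : (W ∘ F) = fun _ => 0 := funext fun N => hc _ (hF N)
  rw [h2] at h1
  simpa using (tendsto_nhds_unique tendsto_const_nhds h1).symm

end CompactSupportDensity

section SquareIntegrableBound

open SchwartzMap Filter Topology MeasureTheory FourierTransform

variable {V : Type} [NormedAddCommGroup V] [InnerProductSpace ℝ V]

/-- Multiplication by the Gaussian `exp (-a ‖x‖²)`. -/
noncomputable def gaussianMul (a : ℝ) (ha : 0 < a) : 𝓢(V, ℂ) →L[ℂ] 𝓢(V, ℂ) :=
  smulLeftCLM ℂ (gaussianSchwartz (V := V) a ha)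

lemma gaussianMul_apply {a : ℝ} (ha : 0 < a) (f : 𝓢(V, ℂ)) (x : V) :
    gaussianMul a ha f x = gaussianSchwartz a ha x * f x := by
  rw [gaussianMul, smulLeftCLM_apply_apply (gaussianSchwartz a ha).hasTemperateGrowth, smul_eq_mul]

lemma seminorm_gaussianMul_le {b : ℝ} (hb : 0 < b) (f : 𝓢(V, ℂ)) (k l : ℕ) {M : ℕ → ℝ}
    (hM : ∀ j x, ‖iteratedFDeriv ℝ j f x‖ ≤ M j) :
    SchwartzMap.seminorm ℝ k l (gaussianMul b hb f) ≤
      ∑ i ∈ Finset.range (l + 1), (l.choose i : ℝ) *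
        SchwartzMap.seminorm ℝ k i (gaussianSchwartz (V := V) b hb) * M (l - i) := by
  have hM0 : ∀ j, 0 ≤ M j := fun j => (norm_nonneg _).trans (hM j 0)
  refine SchwartzMap.seminorm_le_bound ℝ k l _ (Finset.sum_nonneg fun i _ =>
    mul_nonneg (mul_nonneg (by positivity) (apply_nonneg _ _)) (hM0 _)) fun x => ?_
  rw [show (⇑(gaussianMul b hb f) : V → ℂ) = fun x => gaussianSchwartz b hb x * f x from
    funext fun x => gaussianMul_apply hb f x]
  have hL := norm_iteratedFDeriv_mul_le (𝕜 := ℝ) (N := ((⊤ : ℕ∞) : WithTop ℕ∞)) (n := l)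
    ((gaussianSchwartz (V := V) b hb).smooth ⊤) (f.smooth ⊤) x (by exact_mod_cast le_top)
  refine (mul_le_mul_of_nonneg_left hL (by positivity)).trans ?_
  rw [Finset.mul_sum]
  refine Finset.sum_le_sum fun i _ => ?_
  calc ‖x‖ ^ k * ((l.choose i : ℝ) * ‖iteratedFDeriv ℝ i (gaussianSchwartz (V := V) b hb) x‖ *
        ‖iteratedFDeriv ℝ (l - i) f x‖)
      = (l.choose i : ℝ) * (‖x‖ ^ k * ‖iteratedFDeriv ℝ i (gaussianSchwartz (V := V) b hb) x‖) *
        ‖iteratedFDeriv ℝ (l - i) f x‖ := by ring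
    _ ≤ _ := by
      gcongr
      · exact SchwartzMap.le_seminorm ℝ k i _ x
      · exact hM _ x

lemma pow_mul_norm_gaussian_le {a : ℝ} (ha : 0 < a) (k : ℕ) : ∃ C, 0 ≤ C ∧ ∀ x : V,
    ‖x‖ ^ k * ‖gaussianSchwartz (V := V) a ha x‖ ≤
      C * ‖gaussianSchwartz (V := V) (a / 2) (half_pos ha) x‖ := by
  refine ⟨SchwartzMap.seminorm ℝ k 0 (gaussianSchwartz (V := V) (a / 2) (half_pos ha)),
    apply_nonneg _ _, fun x => ?_⟩
  have h1 : gaussianSchwartz (V := V) a ha x =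
      gaussianSchwartz (a / 2) (half_pos ha) x * gaussianSchwartz (a / 2) (half_pos ha) x := by
    simp only [gaussianSchwartz_apply]
    rw [← Complex.exp_add]
    push_cast
    ring_nf
  rw [h1, norm_mul, ← mul_assoc]
  gcongr
  exact norm_pow_mul_le_seminorm ℝ _ k x

variable [FiniteDimensional ℝ V] [MeasurableSpace V] [BorelSpace V]

lemma integral_norm_mul_norm_le (f g : 𝓢(V, ℂ)) :
    ∫ x, ‖f x‖ * ‖g x‖ ≤ ‖f.toLp 2‖ * ‖g.toLp 2‖ := by
  have h := integral_mul_norm_le_Lp_mul_Lq (μ := (volume : Measure V)) (f := f) (g := g)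
    Real.HolderConjugate.two_two (by simpa using f.memLp 2) (by simpa using g.memLp 2)
  rw [norm_toLp' (by norm_num) (by norm_num), norm_toLp' (by norm_num) (by norm_num)]
  simpa using h

lemma norm_iteratedFDeriv_fourier_le_sum (G : 𝓢(V, ℂ)) (j : ℕ) (x : V) :
    ‖iteratedFDeriv ℝ j (𝓕 G : 𝓢(V, ℂ)) x‖ ≤
      (2 * Real.pi) ^ j * ∑ p ∈ Finset.range (j + 1), ∫ v, ‖v‖ ^ p * ‖G v‖ := by
  have h := Real.pow_mul_norm_iteratedFDeriv_fourier_le (f := ⇑G) (K := ⊤) (N := ⊤) (k := j)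
    (n := 0) (G.smooth ⊤) (fun k n _ _ => G.integrable_pow_mul_iteratedFDeriv volume k n)
    le_top le_top x
  simpa [Finset.sum_product, fourier_coe] using h

lemma exists_iteratedFDeriv_fourier_gaussianMul_le {a : ℝ} (ha : 0 < a) (j : ℕ) :
    ∃ C : ℝ, ∀ (ψ : 𝓢(V, ℂ)) (x : V),
      ‖iteratedFDeriv ℝ j (𝓕 (gaussianMul a ha ψ) : 𝓢(V, ℂ)) x‖ ≤ C * ‖ψ.toLp 2 volume‖ := by
  choose C hC0 hC using pow_mul_norm_gaussian_le (V := V) ha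
  set γ := gaussianSchwartz (V := V) (a / 2) (half_pos ha)
  refine ⟨(2 * Real.pi) ^ j * ∑ p ∈ Finset.range (j + 1), C p * ‖γ.toLp 2 volume‖, fun ψ x => ?_⟩
  refine (norm_iteratedFDeriv_fourier_le_sum _ j x).trans ?_
  rw [mul_assoc]
  refine mul_le_mul_of_nonneg_left ?_ (by positivity)
  rw [Finset.sum_mul]
  refine Finset.sum_le_sum fun p _ => ?_
  have hintegrable : Integrable (fun v => ‖γ v‖ * ‖ψ v‖) volume := by
    have := (MemLp.integrable_mul (γ.memLp 2 volume) (ψ.memLp 2 volume)).norm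
    simpa using this
  calc ∫ v, ‖v‖ ^ p * ‖gaussianMul a ha ψ v‖ ≤ ∫ v, C p * (‖γ v‖ * ‖ψ v‖) := by
        refine integral_mono_of_nonneg (.of_forall fun v => by positivity) (hintegrable.const_mul _)
          (.of_forall fun v => ?_)
        simp only
        rw [gaussianMul_apply, norm_mul, ← mul_assoc, ← mul_assoc]
        exact mul_le_mul_of_nonneg_right (hC p v) (norm_nonneg _)
    _ = C p * ∫ v, ‖γ v‖ * ‖ψ v‖ := integral_const_mul _ _
    _ ≤ C p * (‖γ.toLp 2 volume‖ * ‖ψ.toLp 2 volume‖) :=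
        mul_le_mul_of_nonneg_left (integral_norm_mul_norm_le γ ψ) (hC0 p)
    _ = _ := by ring

lemma exists_seminorm_gaussianMul_fourier_gaussianMul_le {a b : ℝ} (ha : 0 < a) (hb : 0 < b)
    (k l : ℕ) : ∃ C, ∀ ψ : 𝓢(V, ℂ),
      SchwartzMap.seminorm ℝ k l (gaussianMul b hb (𝓕 (gaussianMul a ha ψ))) ≤
        C * ‖ψ.toLp 2 volume‖ := by
  choose C hC using exists_iteratedFDeriv_fourier_gaussianMul_le (V := V) ha
  refine ⟨∑ i ∈ Finset.range (l + 1), (l.choose i : ℝ) *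
        SchwartzMap.seminorm ℝ k i (gaussianSchwartz (V := V) b hb) * C (l - i), fun ψ => (seminorm_gaussianMul_le hb _ k l fun j x => hC j ψ x).trans (le_of_eq ?_)⟩
  rw [Finset.sum_mul]
  exact Finset.sum_congr rfl fun i _ => by ring

/-- Regularised by Gaussians on both sides of the Fourier transform, a tempered distribution is
represented by a square integrable function. -/
theorem exists_memLp_representation (U : 𝓢(V, ℂ) →L[ℂ] ℂ) {a b : ℝ} (ha : 0 < a) (hb : 0 < b) :
    ∃ h : V → ℂ, MemLp h 2 ∧ ∀ ψ : 𝓢(V, ℂ),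
      U (gaussianMul b hb (𝓕 (gaussianMul a ha ψ))) = ∫ x, h x * ψ x := by
  let B : 𝓢(V, ℂ) →L[ℂ] ℂ :=
    U ∘L gaussianMul b hb ∘L fourierCLM ℂ 𝓢(V, ℂ) ∘L gaussianMul a ha
  have hB : ∀ ψ, B ψ = U (gaussianMul b hb (𝓕 (gaussianMul a ha ψ))) := fun ψ => rfl
  obtain ⟨C, hC⟩ : ∃ C : ℝ, ∀ ψ : 𝓢(V, ℂ), ‖B ψ‖ ≤ C * ‖ψ.toLp 2 volume‖ := by
    have hcont : Continuous ((normSeminorm ℂ ℂ).comp U.toLinearMap) :=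
      continuous_norm.comp U.continuous
    obtain ⟨s, c, -, hs⟩ := Seminorm.bound_of_continuous (schwartz_withSeminorms ℂ V ℂ) _ hcont
    choose D hD using fun kl : ℕ × ℕ =>
      exists_seminorm_gaussianMul_fourier_gaussianMul_le (V := V) ha hb kl.1 kl.2
    refine ⟨c * ∑ kl ∈ s, |D kl|, fun ψ => ?_⟩
    rw [hB]
    refine (hs _).trans ?_
    rw [_root_.smul_apply, NNReal.smul_def, smul_eq_mul, mul_assoc]
    refine mul_le_mul_of_nonneg_left ?_ c.2
    refine (Seminorm.finset_sup_apply_le (by positivity) fun kl hkl => ?_)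
    have h1 : schwartzSeminormFamily ℂ V ℂ kl (gaussianMul b hb (𝓕 (gaussianMul a ha ψ))) ≤
      D kl * ‖ψ.toLp 2 volume‖ := hD kl ψ
    refine h1.trans ?_
    refine mul_le_mul_of_nonneg_right ?_ (norm_nonneg _)
    exact (le_abs_self _).trans (Finset.single_le_sum (f := fun kl => |D kl|)
      (fun _ _ => abs_nonneg _) hkl)
  have hdense : DenseRange (toLpCLM ℂ ℂ 2 (volume : Measure V)).toLinearMap :=
    denseRange_toLpCLM (by norm_num)
  let L : Lp ℂ 2 (volume : Measure V) →L[ℂ] ℂ :=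
    B.toLinearMap.extendOfNorm (toLpCLM ℂ ℂ 2 (volume : Measure V)).toLinearMap
  have hL : ∀ ψ : 𝓢(V, ℂ), L (ψ.toLp 2) = B ψ := fun ψ =>
    LinearMap.extendOfNorm_eq (f := B.toLinearMap)
      (e := (toLpCLM ℂ ℂ 2 (volume : Measure V)).toLinearMap) hdense ⟨C, hC⟩ ψ
  let w := (InnerProductSpace.toDual ℂ (Lp ℂ 2 (volume : Measure V))).symm L
  refine ⟨fun x => starRingEnd ℂ (w x), (Lp.memLp w).star, fun ψ => ?_⟩
  rw [← hB, ← hL, ← InnerProductSpace.toDual_symm_apply, L2.inner_def]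
  refine integral_congr_ae ?_
  filter_upwards [ψ.coeFn_toLp 2 volume] with x hx
  rw [hx]
  simp [w, mul_comm]

end SquareIntegrableBound

section MomentProblem

open SchwartzMap Filter Topology MeasureTheory FourierTransform

variable {V : Type} [NormedAddCommGroup V] [InnerProductSpace ℝ V]

lemma norm_gaussianSchwartz {a : ℝ} (ha : 0 < a) (x : V) :
    ‖gaussianSchwartz a ha x‖ = Real.exp (-a * ‖x‖ ^ 2) := by
  rw [gaussianSchwartz_apply, show (-a * ‖x‖ ^ 2 : ℂ) = ((-a * ‖x‖ ^ 2 : ℝ) : ℂ) by push_cast; ring,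
    Complex.norm_exp_ofReal]

lemma exp_mul_norm_gaussianSchwartz_le {a : ℝ} (ha : 0 < a) (c : ℝ) (x : V) :
    Real.exp (c * ‖x‖) * ‖gaussianSchwartz a ha x‖ ≤
      Real.exp (c ^ 2 / (2 * a)) * ‖gaussianSchwartz (a / 2) (half_pos ha) x‖ := by
  rw [norm_gaussianSchwartz, norm_gaussianSchwartz, ← Real.exp_add, ← Real.exp_add,
    Real.exp_le_exp]
  have h : 0 ≤ (a * ‖x‖ - c) ^ 2 / (2 * a) := by positivity
  have h2 : (a * ‖x‖ - c) ^ 2 / (2 * a) = a / 2 * ‖x‖ ^ 2 - c * ‖x‖ + c ^ 2 / (2 * a) := by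
    field_simp
    ring
  linarith

variable [FiniteDimensional ℝ V] [MeasurableSpace V] [BorelSpace V]

lemma integrable_mul_schwartz {h : V → ℂ} (hh : MemLp h 2) (f : 𝓢(V, ℂ)) :
    Integrable (fun x => h x * f x) :=
  MemLp.integrable_mul (p := 2) (q := 2) hh (f.memLp 2)

lemma fourier_eq_zero_of_moments_eq_zero {h : V → ℂ} (hh : MemLp h 2) {a : ℝ} (ha : 0 < a)
    (h0 : ∀ (m : ℕ) (ξ : V),
      ∫ x, h x * ((inner ℝ x ξ : ℂ) ^ m * gaussianSchwartz a ha x) = 0) (ξ : V) :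
    𝓕 (fun x => h x * gaussianSchwartz a ha x) ξ = 0 := by
  have hG := integrable_mul_schwartz hh (gaussianSchwartz a ha)
  have hG' := integrable_mul_schwartz hh (gaussianSchwartz (a / 2) (half_pos ha))
  set z : V → ℂ := fun v => ((-2 * Real.pi * inner ℝ v ξ : ℝ) : ℂ) * Complex.I with hz
  have hzn : ∀ v, ‖z v‖ ≤ (2 * Real.pi * ‖ξ‖) * ‖v‖ := fun v => by
    rw [hz, norm_mul, Complex.norm_I, mul_one, Complex.norm_real, norm_mul, norm_mul]
    have := norm_inner_le_norm (𝕜 := ℝ) v ξ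
    rw [norm_neg, Real.norm_of_nonneg zero_le_two, Real.norm_of_nonneg Real.pi_pos.le]
    nlinarith [Real.pi_pos]
  have hz_meas : Measurable z := by fun_prop
  have key : HasSum (fun m : ℕ => ∫ v, (z v ^ m / m.factorial) *
      (h v * gaussianSchwartz a ha v))
      (∫ v, Complex.exp (z v) * (h v * gaussianSchwartz a ha v)) := by
    refine hasSum_integral_of_dominated_convergence
      (fun m v => (((2 * Real.pi * ‖ξ‖) * ‖v‖) ^ m / m.factorial) *
        ‖h v * gaussianSchwartz a ha v‖) ?_ ?_ ?_ ?_ ?_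
    · intro m
      exact (((hz_meas.pow_const m).div_const _).aestronglyMeasurable).mul hG.aestronglyMeasurable
    · intro m
      refine Eventually.of_forall fun v => ?_
      rw [norm_mul, norm_div, norm_pow, Complex.norm_natCast]
      gcongr
      exact hzn v
    · refine Eventually.of_forall fun v => ?_
      exact (Real.summable_pow_div_factorial _).mul_right _
    · have hs : ∀ v, ∑' m : ℕ, (((2 * Real.pi * ‖ξ‖) * ‖v‖) ^ m / m.factorial) *
          ‖h v * gaussianSchwartz a ha v‖ =
          Real.exp ((2 * Real.pi * ‖ξ‖) * ‖v‖) * ‖h v * gaussianSchwartz a ha v‖ := fun v => by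
        rw [tsum_mul_right, Real.exp_eq_exp_ℝ, NormedSpace.exp_eq_tsum_div]
      simp_rw [hs]
      refine (hG'.norm.const_mul (Real.exp ((2 * Real.pi * ‖ξ‖) ^ 2 / (2 * a)))).mono' ?_ ?_
      · exact (Measurable.aestronglyMeasurable (by fun_prop)).mul hG.norm.aestronglyMeasurable
      · refine Eventually.of_forall fun v => ?_
        rw [Real.norm_of_nonneg (by positivity), norm_mul, norm_mul]
        have := mul_le_mul_of_nonneg_left
          (exp_mul_norm_gaussianSchwartz_le ha (2 * Real.pi * ‖ξ‖) v) (norm_nonneg (h v))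
        linarith
    · refine Eventually.of_forall fun v => ?_
      have := NormedSpace.expSeries_div_hasSum_exp (z v)
      rw [← Complex.exp_eq_exp_ℂ] at this
      exact this.mul_right _
  rw [Real.fourier_eq']
  simp only [smul_eq_mul]
  refine key.unique ?_
  convert hasSum_zero using 2 with m
  have : ∀ v, (z v ^ m / m.factorial) * (h v * gaussianSchwartz a ha v) =
      ((-2 * Real.pi * Complex.I) ^ m / m.factorial) *
        (h v * ((inner ℝ v ξ : ℂ) ^ m * gaussianSchwartz a ha v)) := fun v => by
    simp only [hz]
    push_cast
    ring
  simp_rw [this]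
  rw [integral_const_mul, h0, mul_zero]

lemma integral_mul_gaussian_mul_eq_zero {h : V → ℂ} (hh : MemLp h 2) {a : ℝ} (ha : 0 < a)
    (h0 : ∀ (m : ℕ) (ξ : V),
      ∫ x, h x * ((inner ℝ x ξ : ℂ) ^ m * gaussianSchwartz a ha x) = 0) (φ : 𝓢(V, ℂ)) :
    ∫ x, h x * (gaussianSchwartz a ha x * φ x) = 0 := by
  have hG := integrable_mul_schwartz hh (gaussianSchwartz a ha)
  have hflip := VectorFourier.integral_fourierIntegral_smul_eq_flip (L := innerₗ V)
    Real.continuous_fourierChar continuous_inner hG ((𝓕⁻ φ : 𝓢(V, ℂ)).integrable (μ := volume))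
  have hF : ∀ ξ, VectorFourier.fourierIntegral Real.fourierChar volume (innerₗ V)
      (fun x => h x * gaussianSchwartz a ha x) ξ = 0 :=
    fun ξ => fourier_eq_zero_of_moments_eq_zero hh ha h0 ξ
  simp only [hF, zero_smul, integral_zero] at hflip
  have hinv : ∀ x, VectorFourier.fourierIntegral Real.fourierChar volume (innerₗ V).flip
      (𝓕⁻ φ : 𝓢(V, ℂ)) x = φ x := fun x => by
    have h1 : (𝓕 (𝓕⁻ φ : 𝓢(V, ℂ)) : 𝓢(V, ℂ)) x = φ x := by
      rw [FourierTransform.fourier_fourierInv_eq]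
    rw [← h1, fourier_coe]
    simp [VectorFourier.fourierIntegral, Real.fourier_eq, real_inner_comm]
  simp_rw [hinv, smul_eq_mul] at hflip
  rw [hflip]
  congr 1
  ext x
  ring

end MomentProblem

section PolynomialTimesGaussian

open SchwartzMap Filter Topology MeasureTheory FourierTransform LineDeriv

variable {ι : Type} [Fintype ι]

/-- The value of a complex polynomial at a real point. -/
noncomputable def evalReal (p : MvPolynomial ι ℂ) (x : EuclideanSpace ℝ ι) : ℂ :=
  MvPolynomial.eval (fun i => (x i : ℂ)) p

lemma hasTemperateGrowth_evalReal (p : MvPolynomial ι ℂ) :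
    (evalReal p).HasTemperateGrowth := by
  induction p using MvPolynomial.induction_on with
  | C c =>
    convert! Function.HasTemperateGrowth.const (E := EuclideanSpace ℝ ι) c using 1
    ext x
    simp [evalReal]
  | add p q hp hq =>
    convert! hp.add hq using 1
    ext x
    simp [evalReal]
  | mul_X p i hp =>
    convert! hp.mul (Complex.ofRealCLM ∘L
      (EuclideanSpace.proj i : EuclideanSpace ℝ ι →L[ℝ] ℝ)).hasTemperateGrowth using 1
    ext x
    simp [evalReal]

lemma fderiv_evalReal (ℓ : ι → MvPolynomial ι ℂ) (p : MvPolynomial ι ℂ)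
    (x v : EuclideanSpace ℝ ι) (hv : ∀ i, (v i : ℂ) = evalReal (ℓ i) x) :
    fderiv ℝ (evalReal p) x v = evalReal (MvPolynomial.mkDerivation ℂ ℓ p) x := by
  have hd : ∀ p : MvPolynomial ι ℂ, DifferentiableAt ℝ (evalReal p) x := fun p =>
    ((hasTemperateGrowth_evalReal p).1.differentiable (by simp)) x
  induction p using MvPolynomial.induction_on with
  | C c =>
    rw [show evalReal (MvPolynomial.C c : MvPolynomial ι ℂ) = fun _ => c by ext; simp [evalReal]]
    simp [evalReal]
  | add p q hp hq =>
    rw [show evalReal (p + q) = evalReal p + evalReal q by ext; simp [evalReal],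
      fderiv_add (hd p) (hd q), map_add, _root_.add_apply, hp, hq]
    simp [evalReal]
  | mul_X p i hp =>
    have hX : evalReal (MvPolynomial.X i : MvPolynomial ι ℂ) = (Complex.ofRealCLM ∘L
        (EuclideanSpace.proj i : EuclideanSpace ℝ ι →L[ℝ] ℝ)) := by ext; simp [evalReal]
    have hXd : fderiv ℝ (evalReal (MvPolynomial.X i : MvPolynomial ι ℂ)) x v = (v i : ℂ) := by
      rw [hX, ContinuousLinearMap.fderiv]
      simp
    rw [show evalReal (p * MvPolynomial.X i) =
        evalReal p * evalReal (MvPolynomial.X i : MvPolynomial ι ℂ) by ext; simp [evalReal],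
      fderiv_mul (hd p) (hd _), Derivation.leibniz, MvPolynomial.mkDerivation_X,
      _root_.add_apply, _root_.smul_apply, _root_.smul_apply, hXd, hp, hv]
    simp [evalReal]

lemma fderiv_gaussianSchwartz {V : Type} [NormedAddCommGroup V] [InnerProductSpace ℝ V]
    {a : ℝ} (ha : 0 < a) (x v : V) :
    fderiv ℝ (gaussianSchwartz (V := V) a ha) x v =
      -(2 * a * inner ℝ x v : ℝ) * gaussianSchwartz a ha x := by
  have h1 : (gaussianSchwartz (V := V) a ha : V → ℂ) =
      fun y => Complex.exp ((-a * ‖y‖ ^ 2 : ℝ) : ℂ) := by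
    ext y
    rw [gaussianSchwartz_apply]
    push_cast
    rfl
  have h2 : HasFDerivAt (fun y : V => -a * ‖y‖ ^ 2) (-a • (2 • innerSL ℝ x)) x :=
    ((hasStrictFDerivAt_norm_sq x).hasFDerivAt).const_mul (-a)
  have h3 := (Complex.ofRealCLM.hasFDerivAt.comp x h2).cexp
  rw [h1]
  erw [h3.fderiv]
  simp
  ring

/-- The product of a polynomial and the Gaussian `exp (-a ‖x‖²)`. -/
noncomputable def polyGaussian (a : ℝ) (ha : 0 < a) (p : MvPolynomial ι ℂ) :
    𝓢(EuclideanSpace ℝ ι, ℂ) :=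
  smulLeftCLM ℂ (evalReal p) (gaussianSchwartz a ha)

lemma polyGaussian_apply {a : ℝ} (ha : 0 < a) (p : MvPolynomial ι ℂ) (x : EuclideanSpace ℝ ι) :
    polyGaussian a ha p x = evalReal p x * gaussianSchwartz a ha x := by
  rw [polyGaussian, smulLeftCLM_apply_apply (hasTemperateGrowth_evalReal p), smul_eq_mul]

lemma polyGaussian_add {a : ℝ} (ha : 0 < a) (p q : MvPolynomial ι ℂ) :
    polyGaussian a ha (p + q) = polyGaussian a ha p + polyGaussian a ha q := by
  ext x
  simp [polyGaussian_apply, evalReal, add_mul]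

lemma polyGaussian_smul {a : ℝ} (ha : 0 < a) (c : ℂ) (p : MvPolynomial ι ℂ) :
    polyGaussian a ha (c • p) = c • polyGaussian a ha p := by
  ext x
  simp [polyGaussian_apply, evalReal, mul_assoc]

lemma fderiv_polyGaussian {a : ℝ} (ha : 0 < a) (ℓ : ι → MvPolynomial ι ℂ) (p : MvPolynomial ι ℂ)
    (x v : EuclideanSpace ℝ ι) (hv : ∀ i, (v i : ℂ) = evalReal (ℓ i) x) :
    fderiv ℝ (polyGaussian a ha p) x v =
      polyGaussian a ha (MvPolynomial.mkDerivation ℂ ℓ p -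
        (2 * a : ℂ) • ((∑ i, MvPolynomial.X i * ℓ i) * p)) x := by
  have h1 : (polyGaussian a ha p : EuclideanSpace ℝ ι → ℂ) =
      evalReal p * ⇑(gaussianSchwartz (V := EuclideanSpace ℝ ι) a ha) := by
    ext y
    simp [polyGaussian_apply]
  rw [h1, fderiv_mul (((hasTemperateGrowth_evalReal p).1.differentiable (by simp)) x)
    ((gaussianSchwartz a ha).differentiable x), _root_.add_apply, _root_.smul_apply,
    _root_.smul_apply, fderiv_evalReal ℓ p x v hv, fderiv_gaussianSchwartz, polyGaussian_apply]
  have h2 : ((inner ℝ x v : ℝ) : ℂ) = evalReal (∑ i, MvPolynomial.X i * ℓ i) x := by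
    rw [PiLp.inner_apply]
    push_cast
    simp only [evalReal, map_sum, map_mul, MvPolynomial.eval_X] at hv ⊢
    refine Finset.sum_congr rfl fun i _ => ?_
    rw [← hv]
    simp [mul_comm]
  have h3 : evalReal (MvPolynomial.mkDerivation ℂ ℓ p -
      (2 * a : ℂ) • ((∑ i, MvPolynomial.X i * ℓ i) * p)) x =
      evalReal (MvPolynomial.mkDerivation ℂ ℓ p) x - 2 * a * (inner ℝ x v : ℝ) * evalReal p x := by
    rw [h2]
    simp only [evalReal, map_sub, MvPolynomial.smul_eval, map_mul]
    ring
  rw [h3]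
  push_cast
  simp only [smul_eq_mul]
  ring

lemma exists_fourier_polyGaussian_eq (p : MvPolynomial ι ℂ) :
    ∃ q : MvPolynomial ι ℂ, (𝓕 (polyGaussian (2 * Real.pi) Real.two_pi_pos p) :
      𝓢(EuclideanSpace ℝ ι, ℂ)) = polyGaussian (Real.pi / 2) Real.pi_div_two_pos q := by
  classical
  induction p using MvPolynomial.induction_on with
  | C c =>
    refine ⟨MvPolynomial.C (c * (Real.pi / (2 * Real.pi : ℂ)) ^
      (Module.finrank ℝ (EuclideanSpace ℝ ι) / 2 : ℂ)), ?_⟩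
    have h0 : polyGaussian (2 * Real.pi) Real.two_pi_pos (MvPolynomial.C c : MvPolynomial ι ℂ) =
        c • gaussianSchwartz _ Real.two_pi_pos := by
      ext x
      simp [polyGaussian_apply, evalReal]
    rw [h0, FourierTransform.fourier_smul]
    ext w
    rw [_root_.smul_apply, fourier_coe]
    have h1 : (gaussianSchwartz (V := EuclideanSpace ℝ ι) _ Real.two_pi_pos :
        EuclideanSpace ℝ ι → ℂ) = fun v => Complex.exp (-(2 * Real.pi : ℂ) * ‖v‖ ^ 2) := by
      ext v
      rw [gaussianSchwartz_apply]
      push_cast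
      rfl
    rw [h1, fourier_gaussian_innerProductSpace (by simpa using Real.pi_pos), polyGaussian_apply,
      gaussianSchwartz_apply, smul_eq_mul, evalReal, MvPolynomial.eval_C, mul_assoc]
    congr 3
    have : (Real.pi : ℂ) ≠ 0 := by exact_mod_cast Real.pi_ne_zero
    push_cast
    field_simp
  | add p q hp hq =>
    obtain ⟨p', hp⟩ := hp
    obtain ⟨q', hq⟩ := hq
    exact ⟨p' + q', by rw [polyGaussian_add, polyGaussian_add, FourierTransform.fourier_add, hp, hq]⟩
  | mul_X p i hp =>
    obtain ⟨q, hq⟩ := hp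
    set e : EuclideanSpace ℝ ι := EuclideanSpace.single i 1
    let r : MvPolynomial ι ℂ := MvPolynomial.mkDerivation ℂ (Pi.single i 1) q -
        (2 * (Real.pi / 2 : ℝ) : ℂ) • ((∑ j, MvPolynomial.X j *
          (Pi.single i 1 : ι → MvPolynomial ι ℂ) j) * q)
    have hc : (2 * Real.pi * Complex.I) ≠ 0 := by simp [Real.pi_ne_zero]
    have h1 : ∂_{e} (polyGaussian (Real.pi / 2) Real.pi_div_two_pos q) =
        polyGaussian (Real.pi / 2) Real.pi_div_two_pos r := by
      ext x
      rw [lineDerivOp_apply_eq_fderiv]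
      refine fderiv_polyGaussian _ _ q x e fun j => ?_
      by_cases hj : j = i
      · subst hj; simp [e, evalReal]
      · simp [e, evalReal, hj]
    have h2 := SchwartzMap.lineDerivOp_fourier_eq
      (polyGaussian (2 * Real.pi) Real.two_pi_pos p) e
    have h3 : smulLeftCLM ℂ (inner ℝ · e) (polyGaussian (2 * Real.pi) Real.two_pi_pos p) =
        polyGaussian (2 * Real.pi) Real.two_pi_pos (p * MvPolynomial.X i) := by
      ext x
      rw [smulLeftCLM_apply_apply (by fun_prop), polyGaussian_apply, polyGaussian_apply]
      simp [e, evalReal, EuclideanSpace.inner_single_right]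
      ring
    rw [hq, h1, h3, FourierTransform.fourier_smul] at h2
    refine ⟨(-(2 * Real.pi * Complex.I))⁻¹ • r, ?_⟩
    rw [polyGaussian_smul, h2, smul_smul, inv_mul_cancel₀ (neg_ne_zero.2 hc), one_smul]

theorem eq_zero_of_forall_polyGaussian {U : 𝓢(EuclideanSpace ℝ ι, ℂ) →L[ℂ] ℂ}
    (hU : ∀ p : MvPolynomial ι ℂ, U (polyGaussian Real.pi Real.pi_pos p) = 0) : U = 0 := by
  have hmul : ∀ (p : MvPolynomial ι ℂ), gaussianMul Real.pi Real.pi_pos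
      (polyGaussian Real.pi Real.pi_pos p) = polyGaussian (2 * Real.pi) Real.two_pi_pos p := by
    intro p
    ext x
    rw [gaussianMul_apply, polyGaussian_apply, polyGaussian_apply, mul_left_comm]
    simp only [gaussianSchwartz_apply, ← Complex.exp_add]
    push_cast
    ring_nf
  have hmul' : ∀ (p : MvPolynomial ι ℂ), gaussianMul (Real.pi / 2) Real.pi_div_two_pos
      (polyGaussian (Real.pi / 2) Real.pi_div_two_pos p) = polyGaussian Real.pi Real.pi_pos p := by
    intro p
    ext x
    rw [gaussianMul_apply, polyGaussian_apply, polyGaussian_apply, mul_left_comm]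
    simp only [gaussianSchwartz_apply, ← Complex.exp_add]
    push_cast
    ring_nf
  obtain ⟨h, hh, hrep⟩ := exists_memLp_representation U Real.pi_pos Real.pi_div_two_pos
  have hpoly : ∀ p : MvPolynomial ι ℂ, ∫ x, h x * polyGaussian Real.pi Real.pi_pos p x = 0 := by
    intro p
    obtain ⟨q, hq⟩ := exists_fourier_polyGaussian_eq p
    rw [← hrep, hmul, hq, hmul', hU]
  have hzero := integral_mul_gaussian_mul_eq_zero hh Real.pi_pos fun m ξ => by
    rw [← hpoly ((∑ i, MvPolynomial.C (ξ i : ℂ) * MvPolynomial.X i) ^ m)]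
    congr 1
    ext x
    rw [polyGaussian_apply, PiLp.inner_apply]
    simp [evalReal]
  have hW : U ∘L gaussianMul (Real.pi / 2) Real.pi_div_two_pos ∘L
      fourierCLM ℂ 𝓢(EuclideanSpace ℝ ι, ℂ) = 0 := by
    refine eq_zero_of_gaussian_mul Real.two_pi_pos fun φ ψ hψ => ?_
    have h1 : ψ = gaussianMul Real.pi Real.pi_pos (gaussianMul Real.pi Real.pi_pos φ) := by
      ext x
      rw [hψ, gaussianMul_apply, gaussianMul_apply, ← mul_assoc]
      simp only [gaussianSchwartz_apply, ← Complex.exp_add]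
      push_cast
      ring_nf
    rw [h1]
    refine (hrep _).trans ?_
    simp_rw [gaussianMul_apply]
    exact hzero φ
  refine eq_zero_of_gaussian_mul Real.pi_div_two_pos fun φ ψ hψ => ?_
  have h1 : ψ = gaussianMul (Real.pi / 2) Real.pi_div_two_pos (𝓕 (𝓕⁻ φ)) := by
    ext x
    rw [hψ, gaussianMul_apply, FourierTransform.fourier_fourierInv_eq]
  rw [h1]
  exact DFunLike.congr_fun hW (𝓕⁻ φ)

end PolynomialTimesGaussian

section EuclideanPairs

open SchwartzMap MvPolynomial

variable {ι : Type}

lemma evalReal_map (f : MvPolynomial ι ℝ) (x : EuclideanSpace ℝ ι) :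
    evalReal (map (algebraMap ℝ ℂ) f) x = (eval x f : ℝ) := by
  rw [evalReal, eval_map]
  exact (eval₂_comp_left (algebraMap ℝ ℂ) (RingHom.id ℝ) x f).symm

lemma map_mkDerivation {R S σ : Type*} [CommRing R] [CommRing S] [Algebra R S]
    (ℓ : σ → MvPolynomial σ R) (f : MvPolynomial σ R) :
    map (algebraMap R S) (mkDerivation R ℓ f) =
      mkDerivation S (fun k => map (algebraMap R S) (ℓ k)) (map (algebraMap R S) f) := by
  induction f using MvPolynomial.induction_on with
  | C c => simp
  | add p q hp hq => simp [hp, hq]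
  | mul_X p i hp => simp [Derivation.leibniz, hp, mkDerivation_X]

lemma eq_zero_of_map_real {Φ : MvPolynomial ι ℂ →ₗ[ℂ] ℂ}
    (hΦ : ∀ f : MvPolynomial ι ℝ, Φ (map (algebraMap ℝ ℂ) f) = 0) : Φ = 0 := by
  refine LinearMap.ext fun p => ?_
  rw [p.as_sum, map_sum]
  refine Finset.sum_eq_zero fun s _ => ?_
  have h : monomial s (coeff s p) = coeff s p • map (algebraMap ℝ ℂ) (monomial s 1) := by
    rw [map_monomial, map_one, smul_monomial, smul_eq_mul, mul_one]
  rw [h, map_smul, hΦ, smul_zero]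

variable [Fintype ι]

lemma alongField_polyGaussian {a : ℝ} (ha : 0 < a)
    {A : EuclideanSpace ℝ ι →L[ℝ] EuclideanSpace ℝ ι} {ℓ : ι → MvPolynomial ι ℝ}
    (hA : ∀ x k, A x k = eval x (ℓ k)) (f : MvPolynomial ι ℝ) :
    alongField A (polyGaussian a ha (map (algebraMap ℝ ℂ) f)) =
      polyGaussian a ha (map (algebraMap ℝ ℂ)
        (mkDerivation ℝ ℓ f - (2 * a) • ((∑ k, X k * ℓ k) * f))) := by
  ext x
  rw [alongField_apply, fderiv_polyGaussian ha (fun k => map (algebraMap ℝ ℂ) (ℓ k)) _ x (A x)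
    fun k => by rw [evalReal_map, hA]]
  congr 2
  simp [map_mkDerivation, map_sum, smul_eq_C_mul]

lemma compCLM_polyGaussian {a : ℝ} (ha : 0 < a) {σ : Equiv.Perm ι} {ε : ι → ℝ}
    (hε : ∀ k, ε k ^ 2 = 1) {G : EuclideanSpace ℝ ι ≃L[ℝ] EuclideanSpace ℝ ι}
    (hG : ∀ x k, G x k = ε k * x (σ k)) (f : MvPolynomial ι ℝ) :
    compCLMOfContinuousLinearEquiv ℝ G (polyGaussian a ha (map (algebraMap ℝ ℂ) f)) =
      polyGaussian a ha (map (algebraMap ℝ ℂ) (aeval (fun k => C (ε k) * X (σ k)) f)) := by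
  ext x
  have hnorm : ‖G x‖ ^ 2 = ‖x‖ ^ 2 := by
    simp only [EuclideanSpace.norm_sq_eq, hG, norm_mul, mul_pow, Real.norm_eq_abs, sq_abs, hε,
      one_mul]
    exact Equiv.sum_comp σ fun k => x k ^ 2
  have hnorm' : (‖G x‖ : ℂ) ^ 2 = (‖x‖ : ℂ) ^ 2 := by
    exact_mod_cast congrArg Complex.ofReal hnorm
  change polyGaussian a ha _ (G x) = _
  rw [polyGaussian_apply, polyGaussian_apply, evalReal_map, evalReal_map, gaussianSchwartz_apply,
    gaussianSchwartz_apply, hnorm']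
  congr 2
  induction f using MvPolynomial.induction_on with
  | C c => simp
  | add p q hp hq => simp [hp, hq]
  | mul_X p i hp => simp [hp, hG]

variable {n : ℕ}

lemma complex_polynomial_functional_eq_zero {Φ : MvPolynomial (PairIndex n) ℂ →ₗ[ℂ] ℂ}
    {c : ℝ} (hc : c ≠ 0)
    (hrow : ∀ p q f, Φ (map (algebraMap ℝ ℂ) (mkDerivation ℝ (rowField p q) f)) =
      c * Φ (map (algebraMap ℝ ℂ) (rowMoment n p q * f)))
    (hcol : ∀ p q f, Φ (map (algebraMap ℝ ℂ) (mkDerivation ℝ (colField p q) f)) =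
      c * Φ (map (algebraMap ℝ ℂ) (colMoment n p q * f)))
    (hrl : ∀ p f, Φ (map (algebraMap ℝ ℂ) (rowReflection p f)) = Φ (map (algebraMap ℝ ℂ) f))
    (hrr : ∀ p f, Φ (map (algebraMap ℝ ℂ) (colReflection p f)) = Φ (map (algebraMap ℝ ℂ) f))
    (hτ : ∀ f, Φ (map (algebraMap ℝ ℂ) (pairTranspose n f)) = -Φ (map (algebraMap ℝ ℂ) f)) :
    Φ = 0 := by
  have key : ∀ π : ℂ →ₗ[ℝ] ℝ, ∀ f, π (Φ (map (algebraMap ℝ ℂ) f)) = 0 := fun π => by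
    let Λ : MvPolynomial (PairIndex n) ℝ →ₗ[ℝ] ℝ :=
      π ∘ₗ Φ.restrictScalars ℝ ∘ₗ (mapAlgHom (Algebra.ofId ℝ ℂ)).toLinearMap
    have hΛ : ∀ f, Λ f = π (Φ (map (algebraMap ℝ ℂ) f)) := fun f => rfl
    have hπ : ∀ z : ℂ, π (c * z) = c * π z := fun z => by
      rw [← Complex.real_smul, map_smul, smul_eq_mul]
    have : Λ = 0 := polynomial_functional_eq_zero hc
      (fun p q f => by rw [hΛ, hΛ, hrow, hπ]) (fun p q f => by rw [hΛ, hΛ, hcol, hπ])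
      (fun p f => by rw [hΛ, hΛ, hrl]) (fun p f => by rw [hΛ, hΛ, hrr])
      (fun f => by rw [hΛ, hΛ, hτ, map_neg])
    exact fun f => by rw [← hΛ, this, LinearMap.zero_apply]
  exact eq_zero_of_map_real fun f => Complex.ext (key Complex.reLm f) (key Complex.imLm f)

lemma sum_X_mul_rowField (p q : Fin n) :
    ∑ k, X k * rowField p q k = rowMoment n p q := by
  simp only [Fintype.sum_prod_type, Fintype.sum_bool, rowField, rowMoment, genericPair,
    Matrix.sub_apply, Matrix.mul_apply, Matrix.transpose_apply, Matrix.of_apply, if_true,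
    Bool.false_eq_true, if_false]
  rw [Finset.sum_comm, Finset.sum_comm (f := fun i j => X (false, i, j) * _)]
  simp [mul_comm]
  ring

lemma sum_X_mul_colField (p q : Fin n) :
    ∑ k, X k * colField p q k = colMoment n p q := by
  simp only [Fintype.sum_prod_type, Fintype.sum_bool, colField, colMoment, genericPair,
    Matrix.sub_apply, Matrix.mul_apply, Matrix.transpose_apply, Matrix.of_apply, if_true,
    Bool.false_eq_true, if_false]
  simp [mul_comm]
  ring

theorem eq_zero_of_pair_symmetries {U : 𝓢(EuclideanSpace ℝ (PairIndex n), ℂ) →L[ℂ] ℂ}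
    (hrow : ∀ p q, ∃ A : EuclideanSpace ℝ (PairIndex n) →L[ℝ] EuclideanSpace ℝ (PairIndex n),
      (∀ x k, A x k = eval x (rowField p q k)) ∧ ∀ ψ, U (alongField A ψ) = 0)
    (hcol : ∀ p q, ∃ A : EuclideanSpace ℝ (PairIndex n) →L[ℝ] EuclideanSpace ℝ (PairIndex n),
      (∀ x k, A x k = eval x (colField p q k)) ∧ ∀ ψ, U (alongField A ψ) = 0)
    (hrl : ∀ p, ∃ G : EuclideanSpace ℝ (PairIndex n) ≃L[ℝ] EuclideanSpace ℝ (PairIndex n),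
      (∀ x k, G x k = (if k.2.1 = p then -1 else 1) * x k) ∧
        ∀ ψ, U (compCLMOfContinuousLinearEquiv ℝ G ψ) = U ψ)
    (hrr : ∀ p, ∃ G : EuclideanSpace ℝ (PairIndex n) ≃L[ℝ] EuclideanSpace ℝ (PairIndex n),
      (∀ x k, G x k = (if k.2.2 = p then -1 else 1) * x k) ∧
        ∀ ψ, U (compCLMOfContinuousLinearEquiv ℝ G ψ) = U ψ)
    (hτ : ∃ G : EuclideanSpace ℝ (PairIndex n) ≃L[ℝ] EuclideanSpace ℝ (PairIndex n),
      (∀ x k, G x k = x (k.1, k.2.2, k.2.1)) ∧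
        ∀ ψ, U (compCLMOfContinuousLinearEquiv ℝ G ψ) = -U ψ) : U = 0 := by
  let Φ : MvPolynomial (PairIndex n) ℂ →ₗ[ℂ] ℂ :=
    { toFun := fun p => U (polyGaussian Real.pi Real.pi_pos p)
      map_add' := fun p q => by rw [polyGaussian_add, map_add]
      map_smul' := fun c p => by rw [polyGaussian_smul, map_smul, RingHom.id_apply] }
  have hΦ : ∀ p, Φ p = U (polyGaussian Real.pi Real.pi_pos p) := fun p => rfl
  have hfield : ∀ {A : EuclideanSpace ℝ (PairIndex n) →L[ℝ] EuclideanSpace ℝ (PairIndex n)}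
      {ℓ : PairIndex n → MvPolynomial (PairIndex n) ℝ} {μ : MvPolynomial (PairIndex n) ℝ},
      ∑ k, X k * ℓ k = μ → (∀ x k, A x k = eval x (ℓ k)) → (∀ ψ, U (alongField A ψ) = 0) →
      ∀ f, Φ (map (algebraMap ℝ ℂ) (mkDerivation ℝ ℓ f)) =
        (2 * Real.pi : ℝ) * Φ (map (algebraMap ℝ ℂ) (μ * f)) := by
    rintro A ℓ μ rfl hA hU f
    have h := hU (polyGaussian Real.pi Real.pi_pos (map (algebraMap ℝ ℂ) f))
    rw [alongField_polyGaussian _ hA, ← hΦ, map_sub, map_sub, sub_eq_zero] at h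
    rw [h, smul_eq_C_mul, map_mul, map_C, ← smul_eq_C_mul, map_smul, smul_eq_mul]
    rfl
  have hcomp : ∀ {G : EuclideanSpace ℝ (PairIndex n) ≃L[ℝ] EuclideanSpace ℝ (PairIndex n)}
      (σ : Equiv.Perm (PairIndex n)) {ε : PairIndex n → ℝ}, (∀ k, ε k ^ 2 = 1) →
      (∀ x k, G x k = ε k * x (σ k)) → ∀ f, Φ (map (algebraMap ℝ ℂ)
        (aeval (fun k => C (ε k) * X (σ k)) f)) = U (compCLMOfContinuousLinearEquiv ℝ G
          (polyGaussian Real.pi Real.pi_pos (map (algebraMap ℝ ℂ) f))) := by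
    intro G σ ε hε hG f
    rw [compCLM_polyGaussian _ hε hG, hΦ]
  have hΦ0 : Φ = 0 := by
    refine complex_polynomial_functional_eq_zero Real.two_pi_pos.ne' (fun p q f => ?_)
      (fun p q f => ?_) (fun p f => ?_) (fun p f => ?_) (fun f => ?_)
    · obtain ⟨A, hA, hU⟩ := hrow p q
      exact hfield (sum_X_mul_rowField p q) hA hU f
    · obtain ⟨A, hA, hU⟩ := hcol p q
      exact hfield (sum_X_mul_colField p q) hA hU f
    · obtain ⟨G, hG, hU⟩ := hrl p
      rw [hΦ (map _ f), ← hU, ← hcomp (Equiv.refl _) (fun k => by split_ifs <;> simp) hG,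
        rowReflection]
      congr 4
      ext1 k
      split_ifs <;> simp
    · obtain ⟨G, hG, hU⟩ := hrr p
      rw [hΦ (map _ f), ← hU, ← hcomp (Equiv.refl _) (fun k => by split_ifs <;> simp) hG,
        colReflection]
      congr 4
      ext1 k
      split_ifs <;> simp
    · obtain ⟨G, hG, hU⟩ := hτ
      let σ : Equiv.Perm (PairIndex n) := (Equiv.refl Bool).prodCongr (Equiv.prodComm _ _)
      rw [hΦ (map _ f), ← hU, ← hcomp σ (ε := fun _ => 1) (fun k => by simp)
        (fun x k => by rw [hG, one_mul]; rfl), pairTranspose]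
      congr 2
      induction f using MvPolynomial.induction_on with
      | C c => simp
      | add p q hp hq => simp [hp, hq]
      | mul_X p i hp => 
        simp only [map_mul, rename_X, hp, aeval_X, map_one, one_mul]
        rfl
  exact eq_zero_of_forall_polyGaussian fun p => by rw [← hΦ, hΦ0, LinearMap.zero_apply]

end EuclideanPairs

open SchwartzMap Matrix

attribute [local instance] Matrix.normedAddCommGroup Matrix.normedSpace

section MatrixPairs

variable {n : ℕ}

/-- Coordinates `(x, yᵀ)` on the space of pairs of matrices. -/
noncomputable def pairCoords (n : ℕ) : (Matrix (Fin n) (Fin n) ℝ × Matrix (Fin n) (Fin n) ℝ) ≃L[ℝ]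
    EuclideanSpace ℝ (PairIndex n) :=
  LinearEquiv.toContinuousLinearEquiv
    { toFun := fun m => WithLp.toLp 2 fun k => if k.1 then m.2 k.2.2 k.2.1 else m.1 k.2.1 k.2.2
      map_add' := fun x y => by
        ext ⟨b, i, j⟩
        cases b <;> simp
      map_smul' := fun c x => by
        ext ⟨b, i, j⟩
        cases b <;> simp
      invFun := fun v => (Matrix.of fun i j => v (false, i, j), Matrix.of fun i j => v (true, j, i))
      left_inv := fun m => by ext <;> simp
      right_inv := fun v => by
        ext ⟨b, i, j⟩
        cases b <;> simp }

lemma pairCoords_false (m : Matrix (Fin n) (Fin n) ℝ × Matrix (Fin n) (Fin n) ℝ) (i j : Fin n) :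
    pairCoords n m (false, i, j) = m.1 i j := rfl

lemma pairCoords_true (m : Matrix (Fin n) (Fin n) ℝ × Matrix (Fin n) (Fin n) ℝ) (i j : Fin n) :
    pairCoords n m (true, i, j) = m.2 j i := rfl

/-- The linear automorphism `(x, y) ↦ (g x h⁻¹, h y g⁻¹)`. -/
noncomputable def pairAct (g h : (Matrix (Fin n) (Fin n) ℝ)ˣ) :
    (Matrix (Fin n) (Fin n) ℝ × Matrix (Fin n) (Fin n) ℝ) ≃L[ℝ]
      (Matrix (Fin n) (Fin n) ℝ × Matrix (Fin n) (Fin n) ℝ) :=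
  LinearEquiv.toContinuousLinearEquiv
    { toFun := fun m => (g.val * m.1 * h⁻¹.val, h.val * m.2 * g⁻¹.val)
      map_add' := fun x y => by simp [mul_add, add_mul]
      map_smul' := fun c x => by simp
      invFun := fun m => (g⁻¹.val * m.1 * h.val, h⁻¹.val * m.2 * g.val)
      left_inv := fun m => by
        ext1
        · simp only [← mul_assoc, Units.inv_mul, one_mul]
          rw [mul_assoc, Units.inv_mul, mul_one]
        · simp only [← mul_assoc, Units.inv_mul, one_mul]
          rw [mul_assoc, Units.inv_mul, mul_one]
      right_inv := fun m => by
        ext1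
        · simp only [← mul_assoc, Units.mul_inv, one_mul]
          rw [mul_assoc, Units.mul_inv, mul_one]
        · simp only [← mul_assoc, Units.mul_inv, one_mul]
          rw [mul_assoc, Units.mul_inv, mul_one] }

/-- The linear automorphism `(x, y) ↦ (xᵀ, yᵀ)`. -/
noncomputable def pairFlip (n : ℕ) :
    (Matrix (Fin n) (Fin n) ℝ × Matrix (Fin n) (Fin n) ℝ) ≃L[ℝ]
      (Matrix (Fin n) (Fin n) ℝ × Matrix (Fin n) (Fin n) ℝ) :=
  LinearEquiv.toContinuousLinearEquiv
    { toFun := fun m => (m.1ᵀ, m.2ᵀ)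
      map_add' := fun x y => by simp
      map_smul' := fun c x => by simp
      invFun := fun m => (m.1ᵀ, m.2ᵀ)
      left_inv := fun m => by simp
      right_inv := fun m => by simp }

lemma pairAct_apply (g h : (Matrix (Fin n) (Fin n) ℝ)ˣ)
    (m : Matrix (Fin n) (Fin n) ℝ × Matrix (Fin n) (Fin n) ℝ) :
    pairAct g h m = (g.val * m.1 * h⁻¹.val, h.val * m.2 * g⁻¹.val) := rfl

lemma pairFlip_apply (m : Matrix (Fin n) (Fin n) ℝ × Matrix (Fin n) (Fin n) ℝ) :
    pairFlip n m = (m.1ᵀ, m.2ᵀ) := rfl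

/-- A linear automorphism of the space of pairs of matrices, read in coordinates. -/
noncomputable def inCoords (G : (Matrix (Fin n) (Fin n) ℝ × Matrix (Fin n) (Fin n) ℝ) ≃L[ℝ]
    (Matrix (Fin n) (Fin n) ℝ × Matrix (Fin n) (Fin n) ℝ)) :
    EuclideanSpace ℝ (PairIndex n) ≃L[ℝ] EuclideanSpace ℝ (PairIndex n) :=
  (pairCoords n).symm.trans (G.trans (pairCoords n))

lemma inCoords_pairCoords (G : (Matrix (Fin n) (Fin n) ℝ × Matrix (Fin n) (Fin n) ℝ) ≃L[ℝ]
    (Matrix (Fin n) (Fin n) ℝ × Matrix (Fin n) (Fin n) ℝ))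
    (m : Matrix (Fin n) (Fin n) ℝ × Matrix (Fin n) (Fin n) ℝ) :
    inCoords G (pairCoords n m) = pairCoords n (G m) := by
  simp [inCoords]

/-- The linear map copying the coordinate `σ k` to the coordinate `k` when `s k` holds. -/
noncomputable def copyCoords {ι : Type} [Fintype ι] (s : ι → Prop) [DecidablePred s] (σ : ι → ι) :
    EuclideanSpace ℝ ι →L[ℝ] EuclideanSpace ℝ ι :=
  LinearMap.toContinuousLinearMap
    { toFun := fun x => WithLp.toLp 2 fun k => if s k then x (σ k) else 0
      map_add' := fun x y => by
        ext k
        by_cases hk : s k <;> simp [hk]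
      map_smul' := fun c x => by
        ext k
        by_cases hk : s k <;> simp [hk] }

lemma copyCoords_apply {ι : Type} [Fintype ι] (s : ι → Prop) [DecidablePred s] (σ : ι → ι)
    (x : EuclideanSpace ℝ ι) (k : ι) :
    copyCoords s σ x k = if s k then x (σ k) else 0 := rfl

/-- The parameter of a one-parameter group of elementary matrices. -/
noncomputable def elementaryParam (p q : Fin n) (t : ℝ) : ℝ :=
  if p = q then Real.exp t - 1 else t

lemma elementaryParam_zero (p q : Fin n) : elementaryParam p q 0 = 0 := by
  simp [elementaryParam]

lemma hasDerivAt_elementaryParam (p q : Fin n) : HasDerivAt (elementaryParam p q) 1 0 := by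
  by_cases h : p = q
  · have : elementaryParam p q = fun t => Real.exp t - 1 := by
      ext t
      simp [elementaryParam, h]
    rw [this]
    simpa using (Real.hasDerivAt_exp 0).sub_const 1
  · have : elementaryParam p q = fun t => t := by
      ext t
      simp [elementaryParam, h]
    rw [this]
    exact hasDerivAt_id 0

lemma one_add_single_mul_one_add_single (p q : Fin n) (t : ℝ) :
    (1 + Matrix.single p q (elementaryParam p q t)) *
      (1 + Matrix.single p q (elementaryParam p q (-t))) = 1 := by
  rw [add_mul, one_mul, mul_add, mul_one]
  by_cases h : p = q
  · subst h
    rw [Matrix.single_mul_single_same, add_assoc, ← Matrix.single_add, ← Matrix.single_add]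
    have : elementaryParam p p (-t) + (elementaryParam p p t +
        elementaryParam p p t * elementaryParam p p (-t)) = 0 := by
      simp only [elementaryParam, if_true]
      have := Real.exp_add t (-t)
      rw [add_neg_cancel, Real.exp_zero] at this
      linarith
    rw [this, Matrix.single_zero, add_zero]
  · rw [Matrix.single_mul_single_of_ne _ _ _ _ (Ne.symm h), add_zero, add_assoc,
      ← Matrix.single_add]
    simp [elementaryParam, h]

/-- The one-parameter group of elementary matrices in position `(p, q)`. -/
noncomputable def elementaryUnit (p q : Fin n) (t : ℝ) : (Matrix (Fin n) (Fin n) ℝ)ˣ where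
  val := 1 + Matrix.single p q (elementaryParam p q t)
  inv := 1 + Matrix.single p q (elementaryParam p q (-t))
  val_inv := one_add_single_mul_one_add_single p q t
  inv_val := by simpa using one_add_single_mul_one_add_single p q (-t)

/-- The reflection negating one basis vector. -/
noncomputable def reflectionUnit (p : Fin n) : (Matrix (Fin n) (Fin n) ℝ)ˣ where
  val := Matrix.diagonal fun i => if i = p then -1 else 1
  inv := Matrix.diagonal fun i => if i = p then -1 else 1
  val_inv := by
    rw [Matrix.diagonal_mul_diagonal, ← Matrix.diagonal_one]
    congr 1
    ext i
    split_ifs <;> simp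
  inv_val := by
    rw [Matrix.diagonal_mul_diagonal, ← Matrix.diagonal_one]
    congr 1
    ext i
    split_ifs <;> simp

lemma one_add_single_mul_apply (p q i j : Fin n) (c : ℝ) (m : Matrix (Fin n) (Fin n) ℝ) :
    ((1 + Matrix.single p q c) * m) i j = m i j + if i = p then c * m q j else 0 := by
  rw [add_mul, one_mul, Matrix.add_apply]
  split_ifs with h
  · rw [h, Matrix.single_mul_apply_same]
  · rw [Matrix.single_mul_apply_of_ne _ _ _ _ _ h]

lemma mul_one_add_single_apply (p q i j : Fin n) (c : ℝ) (m : Matrix (Fin n) (Fin n) ℝ) :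
    (m * (1 + Matrix.single p q c)) i j = m i j + if j = q then c * m i p else 0 := by
  rw [mul_add, mul_one, Matrix.add_apply]
  split_ifs with h
  · rw [h, Matrix.mul_single_apply_same, mul_comm]
  · rw [Matrix.mul_single_apply_of_ne _ _ _ _ _ h]

lemma inCoords_pairAct_row (p q : Fin n) (t : ℝ) :
    (inCoords (pairAct (elementaryUnit p q t) 1) :
      EuclideanSpace ℝ (PairIndex n) →L[ℝ] EuclideanSpace ℝ (PairIndex n)) =
    1 + elementaryParam p q t • copyCoords (fun k => k.1 = false ∧ k.2.1 = p)
        (fun k => (false, q, k.2.2)) +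
      elementaryParam p q (-t) • copyCoords (fun k => k.1 = true ∧ k.2.1 = q)
        (fun k => (true, p, k.2.2)) := by
  ext x k
  obtain ⟨m, rfl⟩ := (pairCoords n).surjective x
  obtain ⟨b, i, j⟩ := k
  simp only [ContinuousLinearEquiv.coe_coe, inCoords_pairCoords, pairAct_apply, inv_one,
    Units.val_one, mul_one, one_mul]
  cases b
  · rw [pairCoords_false]
    simp [copyCoords_apply, pairCoords_false, elementaryUnit, one_add_single_mul_apply]
  · rw [pairCoords_true]
    simp [copyCoords_apply, pairCoords_true, elementaryUnit, mul_one_add_single_apply]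

lemma inCoords_pairAct_col (p q : Fin n) (t : ℝ) :
    (inCoords (pairAct 1 (elementaryUnit p q t)⁻¹) :
      EuclideanSpace ℝ (PairIndex n) →L[ℝ] EuclideanSpace ℝ (PairIndex n)) =
    1 + elementaryParam p q t • copyCoords (fun k => k.1 = false ∧ k.2.2 = q)
        (fun k => (false, k.2.1, p)) +
      elementaryParam p q (-t) • copyCoords (fun k => k.1 = true ∧ k.2.2 = p)
        (fun k => (true, k.2.1, q)) := by
  ext x k
  obtain ⟨m, rfl⟩ := (pairCoords n).surjective x
  obtain ⟨b, i, j⟩ := k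
  simp only [ContinuousLinearEquiv.coe_coe, inCoords_pairCoords, pairAct_apply, inv_one,
    Units.val_one, mul_one, one_mul, inv_inv]
  cases b
  · rw [pairCoords_false]
    simp [copyCoords_apply, pairCoords_false, elementaryUnit, mul_one_add_single_apply]
  · rw [pairCoords_true]
    simp [copyCoords_apply, pairCoords_true, elementaryUnit, one_add_single_mul_apply]

lemma map_alongField_sub_eq_zero {V : Type} [NormedAddCommGroup V] [NormedSpace ℝ V]
    {U : 𝓢(V, ℂ) →L[ℂ] ℂ} {G : ℝ → V ≃L[ℝ] V}
    (hU : ∀ t ψ, U (compCLMOfContinuousLinearEquiv ℝ (G t) ψ) = U ψ)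
    {α : ℝ → ℝ} (hα₀ : α 0 = 0) (hα : HasDerivAt α 1 0) {L M : V →L[ℝ] V}
    (hG : ∀ t, (G t : V →L[ℝ] V) = 1 + α t • L + α (-t) • M) (ψ : 𝓢(V, ℂ)) :
    U (alongField (L - M) ψ) = 0 := by
  refine map_alongField_eq_zero U (g := G) ?_ ?_ hU ψ
  · rw [hG, neg_zero, hα₀, zero_smul, zero_smul, add_zero, add_zero]
  · have hα' : HasDerivAt (fun t => α (-t)) (-1) 0 := by
      have h : HasDerivAt α 1 (-0) := by rwa [neg_zero]
      simpa [Function.comp_def] using h.comp (0 : ℝ) (hasDerivAt_neg (0 : ℝ))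
    simp_rw [hG]
    have := ((hα.smul_const L).const_add (1 : V →L[ℝ] V)).add (hα'.smul_const M)
    rw [one_smul, neg_one_smul, ← sub_eq_add_neg] at this
    exact this

theorem eq_zero_of_equivariant_of_transpose_eq_neg
    {T : 𝓢(Matrix (Fin n) (Fin n) ℝ × Matrix (Fin n) (Fin n) ℝ, ℂ) →L[ℂ] ℂ}
    (hinv : ∀ g h φ, T (compCLMOfContinuousLinearEquiv ℂ (pairAct g h) φ) = T φ)
    (hflip : ∀ φ, T (compCLMOfContinuousLinearEquiv ℂ (pairFlip n) φ) = -T φ) : T = 0 := by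
  let U : 𝓢(EuclideanSpace ℝ (PairIndex n), ℂ) →L[ℂ] ℂ :=
    T ∘L compCLMOfContinuousLinearEquiv ℂ (pairCoords n)
  have hU : ∀ G ψ, U (compCLMOfContinuousLinearEquiv ℝ (inCoords G) ψ) =
      T (compCLMOfContinuousLinearEquiv ℂ G (compCLMOfContinuousLinearEquiv ℂ (pairCoords n) ψ)) :=
    fun G ψ => by
      change T _ = T _
      refine congrArg T (SchwartzMap.ext fun m => ?_)
      exact congrArg ψ (inCoords_pairCoords G m)
  have hUact : ∀ g h ψ, U (compCLMOfContinuousLinearEquiv ℝ (inCoords (pairAct g h)) ψ) = U ψ :=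
    fun g h ψ => by rw [hU, hinv]; rfl
  have hU0 : U = 0 := by
    refine eq_zero_of_pair_symmetries (fun p q => ?_) (fun p q => ?_) (fun p => ?_) (fun p => ?_) ?_
    · refine ⟨_, ?_, map_alongField_sub_eq_zero (fun t => hUact (elementaryUnit p q t) 1)
        (elementaryParam_zero p q) (hasDerivAt_elementaryParam p q) (inCoords_pairAct_row p q)⟩
      rintro x ⟨b, i, j⟩
      cases b
      · by_cases h : i = p <;> simp [copyCoords_apply, rowField, h]
      · by_cases h : i = q <;> simp [copyCoords_apply, rowField, h]
    · refine ⟨_, ?_, map_alongField_sub_eq_zero (fun t => hUact 1 (elementaryUnit p q t)⁻¹)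
        (elementaryParam_zero p q) (hasDerivAt_elementaryParam p q) (inCoords_pairAct_col p q)⟩
      rintro x ⟨b, i, j⟩
      cases b
      · by_cases h : j = q <;> simp [copyCoords_apply, colField, h]
      · by_cases h : j = p <;> simp [copyCoords_apply, colField, h]
    · refine ⟨inCoords (pairAct (reflectionUnit p) 1), fun x k => ?_, hUact _ _⟩
      obtain ⟨m, rfl⟩ := (pairCoords n).surjective x
      obtain ⟨b, i, j⟩ := k
      rw [inCoords_pairCoords, pairAct_apply]
      cases b
      · simp [pairCoords_false, reflectionUnit, Matrix.diagonal_mul]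
      · simp [pairCoords_true, reflectionUnit, Matrix.mul_diagonal]
    · refine ⟨inCoords (pairAct 1 (reflectionUnit p)), fun x k => ?_, hUact _ _⟩
      obtain ⟨m, rfl⟩ := (pairCoords n).surjective x
      obtain ⟨b, i, j⟩ := k
      rw [inCoords_pairCoords, pairAct_apply]
      cases b
      · simp [pairCoords_false, reflectionUnit, Matrix.mul_diagonal]
      · simp [pairCoords_true, reflectionUnit, Matrix.diagonal_mul]
    · refine ⟨inCoords (pairFlip n), fun x k => ?_, fun ψ => by rw [hU, hflip]; rfl⟩
      obtain ⟨m, rfl⟩ := (pairCoords n).surjective x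
      obtain ⟨b, i, j⟩ := k
      rw [inCoords_pairCoords, pairFlip_apply]
      cases b <;> rfl
  ext φ
  have h1 : φ = compCLMOfContinuousLinearEquiv ℂ (pairCoords n)
      (compCLMOfContinuousLinearEquiv ℂ (pairCoords n).symm φ) := by
    ext m
    exact congrArg φ ((pairCoords n).symm_apply_apply m).symm
  rw [h1]
  exact DFunLike.congr_fun hU0 _

/-- The inverse transpose of an invertible matrix. -/
noncomputable def invTransposeUnit (g : (Matrix (Fin n) (Fin n) ℝ)ˣ) :
    (Matrix (Fin n) (Fin n) ℝ)ˣ where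
  val := g⁻¹.valᵀ
  inv := g.valᵀ
  val_inv := by rw [← Matrix.transpose_mul, Units.mul_inv, Matrix.transpose_one]
  inv_val := by rw [← Matrix.transpose_mul, Units.inv_mul, Matrix.transpose_one]

lemma pairAct_pairFlip (g h : (Matrix (Fin n) (Fin n) ℝ)ˣ)
    (m : Matrix (Fin n) (Fin n) ℝ × Matrix (Fin n) (Fin n) ℝ) :
    pairAct g h (pairFlip n m) =
      pairFlip n (pairAct (invTransposeUnit h) (invTransposeUnit g) m) := by
  simp only [pairAct_apply, pairFlip_apply, Matrix.transpose_mul, mul_assoc]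
  rfl

end MatrixPairs

theorem equivariant_tempered_distribution_transpose_invariant_pairs
    (n : ℕ) (hn : 0 < n)
    (T : 𝓢(Matrix (Fin n) (Fin n) ℝ × Matrix (Fin n) (Fin n) ℝ, ℂ) →L[ℂ] ℂ)
    (hinv : ∀ (g h : (Matrix (Fin n) (Fin n) ℝ)ˣ)
      (φ ψ : 𝓢(Matrix (Fin n) (Fin n) ℝ × Matrix (Fin n) (Fin n) ℝ, ℂ)),
      (∀ p : Matrix (Fin n) (Fin n) ℝ × Matrix (Fin n) (Fin n) ℝ,
        ψ p = φ ((g : Matrix (Fin n) (Fin n) ℝ) * p.1 * (↑h⁻¹ : Matrix (Fin n) (Fin n) ℝ),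
          (h : Matrix (Fin n) (Fin n) ℝ) * p.2 * (↑g⁻¹ : Matrix (Fin n) (Fin n) ℝ))) →
      T ψ = T φ) :
    ∀ (φ ψ : 𝓢(Matrix (Fin n) (Fin n) ℝ × Matrix (Fin n) (Fin n) ℝ, ℂ)),
      (∀ p : Matrix (Fin n) (Fin n) ℝ × Matrix (Fin n) (Fin n) ℝ, ψ p = φ (p.1ᵀ, p.2ᵀ)) →
      T ψ = T φ := by
  intro φ ψ hψ
  have hact : ∀ g h φ, T (compCLMOfContinuousLinearEquiv ℂ (pairAct g h) φ) = T φ :=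
    fun g h φ => hinv g h _ _ fun p => rfl
  have hzero : T ∘L compCLMOfContinuousLinearEquiv ℂ (pairFlip n) - T = 0 := by
    refine eq_zero_of_equivariant_of_transpose_eq_neg (fun g h φ => ?_) fun φ => ?_
    · have hcomm : compCLMOfContinuousLinearEquiv ℂ (pairFlip n)
          (compCLMOfContinuousLinearEquiv ℂ (pairAct g h) φ) =
          compCLMOfContinuousLinearEquiv ℂ (pairAct (invTransposeUnit h) (invTransposeUnit g))
            (compCLMOfContinuousLinearEquiv ℂ (pairFlip n) φ) := by
        ext m
        exact congrArg φ (pairAct_pairFlip g h m)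
      simp only [_root_.sub_apply, ContinuousLinearMap.comp_apply]
      rw [hcomm, hact, hact]
    · have hinvol : compCLMOfContinuousLinearEquiv ℂ (pairFlip n)
          (compCLMOfContinuousLinearEquiv ℂ (pairFlip n) φ) = φ := by
        ext m
        rfl
      simp only [_root_.sub_apply, ContinuousLinearMap.comp_apply]
      rw [hinvol, neg_sub]
  have h1 : ψ = compCLMOfContinuousLinearEquiv ℂ (pairFlip n) φ := by
    ext m
    exact hψ m
  rw [h1]
  exact sub_eq_zero.1 (DFunLike.congr_fun hzero φ)
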